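/- arXiv:1901.02289 — 2 statements merged into one kernel-verified Lean document; each statement's English description precedes it below -/
import Mathlib

section
/- Fix integers m ≥ 1, n ≥ 2, N ≥ 1, and distinct points x̂₁, …, x̂_N ∈ ℂⁿ. Let x_1, …, x_N : ℂ^m → ℂⁿ be holomorphic maps such that x_i(w) ≠ x_j(w) for all w ∈ ℂ^m whenever i ≠ j. Then there exists a holomorphic map α : ℂ^m × ℂⁿ → ℂⁿ such that for every w ∈ ℂ^m the map α(w, ·) is a holomorphic automorphism of ℂⁿ and α(w, x̂_i) = x_i(w) for all i = 1, …, N and all w ∈ ℂ^m. -/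
open Metric Set Filter Topology

section Holomorphic

variable {E F : Type*} [NormedAddCommGroup E] [NormedSpace ℂ E]
  [NormedAddCommGroup F] [NormedSpace ℂ F]

/-- Cauchy's estimate for the Fréchet derivative. -/
theorem norm_fderiv_le_of_closedBall {f : E → F} {x : E} {ρ C : ℝ} (hρ : 0 < ρ) (hC0 : 0 ≤ C)
    (hd : ∀ y ∈ closedBall x ρ, DifferentiableAt ℂ f y)
    (hC : ∀ y ∈ closedBall x ρ, ‖f y‖ ≤ C) : ‖fderiv ℂ f x‖ ≤ C / ρ := by
  refine ContinuousLinearMap.opNorm_le_bound _ (by positivity) fun v => ?_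
  rcases eq_or_ne v 0 with rfl | hv
  · simp
  have hv' : 0 < ‖v‖ := norm_pos_iff.2 hv
  have hmem : ∀ t : ℂ, ‖t‖ ≤ ρ / ‖v‖ → x + t • v ∈ closedBall x ρ := by
    intro t ht
    rw [mem_closedBall_iff_norm, add_sub_cancel_left, norm_smul]
    rwa [le_div_iff₀ hv'] at ht
  have hline : ∀ t : ℂ, HasDerivAt (fun t : ℂ => x + t • v) v t := fun t => by
    simpa using ((hasDerivAt_id t).smul_const v).const_add x
  have hg : ∀ t : ℂ, ‖t‖ ≤ ρ / ‖v‖ →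
      HasDerivAt (fun t : ℂ => f (x + t • v)) (fderiv ℂ f (x + t • v) v) t := fun t ht =>
    (hd _ (hmem t ht)).hasFDerivAt.comp_hasDerivAt t (hline t)
  have h0 := hg 0 (by simp; positivity)
  have hR : 0 < ρ / ‖v‖ := by positivity
  have key := Complex.norm_deriv_le_of_forall_mem_sphere_norm_le (c := 0) (C := C)
    (f := fun t : ℂ => f (x + t • v)) hR ?_ ?_
  · rw [h0.deriv] at key
    simp only [zero_smul, add_zero] at key
    calc _ ≤ _ := key
      _ = _ := by field_simp
  · apply DifferentiableOn.diffContOnCl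
    rw [closure_ball _ hR.ne']
    intro t ht
    exact (hg t (by simpa using ht)).differentiableAt.differentiableWithinAt
  · intro t ht
    exact hC _ (hmem t (by simpa using (mem_sphere_zero_iff_norm.1 ht).le))

/-- Weierstrass' theorem: a uniform limit of holomorphic maps is holomorphic. -/
theorem differentiableAt_of_tendstoUniformlyOn [CompleteSpace F] {f : ℕ → E → F} {g : E → F}
    {x : E} {ρ : ℝ} (hρ : 0 < ρ)
    (hd : ∀ᶠ n in atTop, ∀ y ∈ ball x ρ, DifferentiableAt ℂ (f n) y)
    (hf : TendstoUniformlyOn f g atTop (ball x ρ)) : DifferentiableAt ℂ g x := by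
  have hsub : ∀ z ∈ ball x (ρ / 2), closedBall z (ρ / 4) ⊆ ball x ρ := fun z hz y hy => by
    rw [mem_ball] at hz ⊢
    rw [mem_closedBall] at hy
    linarith [dist_triangle y z x]
  have hcau : UniformCauchySeqOn (fun n => fderiv ℂ (f n)) atTop (ball x (ρ / 2)) := by
    rw [Metric.uniformCauchySeqOn_iff]
    intro ε hε
    obtain ⟨N₁, hN₁⟩ := eventually_atTop.1 hd
    obtain ⟨N₂, hN₂⟩ := (Metric.uniformCauchySeqOn_iff.1 hf.uniformCauchySeqOn)
      (ε * (ρ / 4) / 2) (by positivity)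
    refine ⟨max N₁ N₂, fun a ha b hb z hz => ?_⟩
    have hda : ∀ y ∈ closedBall z (ρ / 4), DifferentiableAt ℂ (f a) y := fun y hy =>
      hN₁ a (le_trans (le_max_left _ _) ha) y (hsub z hz hy)
    have hdb : ∀ y ∈ closedBall z (ρ / 4), DifferentiableAt ℂ (f b) y := fun y hy =>
      hN₁ b (le_trans (le_max_left _ _) hb) y (hsub z hz hy)
    have hz' : z ∈ closedBall z (ρ / 4) := mem_closedBall_self (by positivity)
    have := norm_fderiv_le_of_closedBall (f := fun y => f a y - f b y) (x := z) (ρ := ρ / 4)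
      (C := ε * (ρ / 4) / 2) (by positivity) (by positivity)
      (fun y hy => (hda y hy).sub (hdb y hy)) (fun y hy => by
        rw [← dist_eq_norm]
        exact (hN₂ a (le_trans (le_max_right _ _) ha) b (le_trans (le_max_right _ _) hb) y
          (hsub z hz hy)).le)
    rw [fderiv_fun_sub (hda z hz') (hdb z hz')] at this
    rw [dist_eq_norm]
    refine this.trans_lt ?_
    rw [show ε * (ρ / 4) / 2 / (ρ / 4) = ε / 2 by field_simp]
    linarith
  have hlim : ∀ z, ∃ l, z ∈ ball x (ρ / 2) →
      Tendsto (fun n => fderiv ℂ (f n) z) atTop (𝓝 l) := fun z => by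
    by_cases hz : z ∈ ball x (ρ / 2)
    · obtain ⟨l, hl⟩ := cauchySeq_tendsto_of_complete (hcau.cauchySeq hz)
      exact ⟨l, fun _ => hl⟩
    · exact ⟨0, fun h => (hz h).elim⟩
  choose g' hg' using hlim
  have hx : x ∈ ball x (ρ / 2) := mem_ball_self (by positivity)
  have hnhds : ball x (ρ / 2) ∈ 𝓝 x := isOpen_ball.mem_nhds hx
  have hunif : TendstoUniformlyOnFilter (fun n => fderiv ℂ (f n)) g' atTop (𝓝 x) :=
    (hcau.tendstoUniformlyOn_of_tendsto fun z hz => hg' z hz).tendstoUniformlyOnFilter.mono_right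
      (le_principal_iff.2 hnhds)
  have hss : ball x (ρ / 2) ⊆ ball x ρ := ball_subset_ball (by linarith)
  refine (hasFDerivAt_of_tendstoUniformlyOnFilter (𝕜 := ℂ) (f := f) hunif ?_ ?_).differentiableAt
  · have := hd.prod_mk (eventually_mem_set.2 hnhds)
    filter_upwards [this] with q hq using (hq.1 q.2 (hss hq.2)).hasFDerivAt
  · filter_upwards [hnhds] with z hz using hf.tendsto_at (hss hz)

/-- A first-order Taylor estimate, uniform on balls, for entire maps on a finite-dimensional
space. -/
theorem exists_norm_taylor_le [ProperSpace E] {f : E → F} (hf : Differentiable ℂ f) (ρ : ℝ) :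
    ∃ C : ℝ, 0 ≤ C ∧ ∀ a ∈ closedBall (0 : E) ρ, ∀ v : E, ‖v‖ ≤ 1 →
      ‖f (a + v) - f a - fderiv ℂ f a v‖ ≤ C * ‖v‖ ^ 2 := by
  obtain ⟨C, hC⟩ := (isCompact_closedBall (0 : E) (ρ + 3)).exists_bound_of_continuousOn
    hf.continuous.continuousOn
  have hbd : ∀ k : ℝ, ∀ y : E, ‖y‖ ≤ k → k ≤ ρ + 3 → ‖f y‖ ≤ max C 0 := fun k y hy hk =>
    (hC y (by simpa using hy.trans hk)).trans (le_max_left _ _)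
  have hC0 : 0 ≤ max C 0 := le_max_right _ _
  -- first derivatives are bounded
  have h1 : ∀ y : E, ‖y‖ ≤ ρ + 2 → ‖fderiv ℂ f y‖ ≤ max C 0 := fun y hy => by
    have := norm_fderiv_le_of_closedBall (f := f) (x := y) one_pos hC0 (fun z _ => hf z)
      (fun z hz => hbd (ρ + 3) z (by
        have := norm_le_norm_add_norm_sub y z
        rw [mem_closedBall_iff_norm'] at hz
        linarith) le_rfl)
    simpa using this
  have h1' : ∀ y z : E, ‖y‖ ≤ ρ + 2 → ‖z‖ ≤ ρ + 2 → ‖f y - f z‖ ≤ max C 0 * ‖y - z‖ :=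
    fun y z hy hz => Convex.norm_image_sub_le_of_norm_fderiv_le (𝕜 := ℂ)
      (s := closedBall (0 : E) (ρ + 2)) (fun u _ => hf u)
      (fun u hu => h1 u (by simpa using hu)) (convex_closedBall _ _)
      (by simpa using hz) (by simpa using hy)
  refine ⟨max C 0, hC0, fun a ha v hv => ?_⟩
  rw [mem_closedBall_zero_iff] at ha
  have h2 : ∀ y ∈ closedBall a ‖v‖, ‖fderiv ℂ f y - fderiv ℂ f a‖ ≤ max C 0 * ‖v‖ := fun y hy => by
    rw [mem_closedBall_iff_norm] at hy
    have hd' : Differentiable ℂ fun z => f (z + (y - a)) := hf.comp (differentiable_id.add_const _)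
    have hfd : fderiv ℂ (fun z => f (z + (y - a)) - f z) a = fderiv ℂ f y - fderiv ℂ f a := by
      rw [fderiv_fun_sub (hd' a) (hf a), fderiv_comp_add_right]
      simp
    rw [← hfd]
    have := norm_fderiv_le_of_closedBall (f := fun z => f (z + (y - a)) - f z) (x := a)
      (C := max C 0 * ‖v‖) one_pos (by positivity)
      (fun z _ => (hd' z).sub (hf z)) (fun z hz => by
        rw [mem_closedBall_iff_norm'] at hz
        have hz' : ‖z‖ ≤ ρ + 1 := by
          have := norm_le_norm_add_norm_sub a z
          linarith
        refine (h1' _ _ ?_ (by linarith)).trans ?_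
        · exact (norm_add_le _ _).trans (by linarith)
        · rw [add_sub_cancel_left]
          gcongr)
    simpa using this
  have := (convex_closedBall a ‖v‖).norm_image_sub_le_of_norm_hasFDerivWithin_le' (𝕜 := ℂ)
    (f := f) (f' := fderiv ℂ f) (φ := fderiv ℂ f a) (x := a) (y := a + v)
    (fun y _ => (hf y).hasFDerivAt.hasFDerivWithinAt) h2
    (mem_closedBall_self (norm_nonneg _)) (by simp)
  rw [add_sub_cancel_left] at this
  calc _ ≤ _ := this
    _ = _ := by ring

end Holomorphic

section Bezout

variable {m : ℕ}

/-- Restrictions of entire functions to a closed ball. -/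
def entireSubalgebra (m : ℕ) (R : ℝ) :
    Subalgebra ℂ C(closedBall (0 : EuclideanSpace ℂ (Fin m)) R, ℂ) where
  carrier := {g | ∃ f : EuclideanSpace ℂ (Fin m) → ℂ, Differentiable ℂ f ∧ ∀ w, g w = f w}
  mul_mem' := by
    rintro a b ⟨f, hf, hfa⟩ ⟨g, hg, hgb⟩
    exact ⟨fun w => f w * g w, hf.mul hg, fun w => by simp [hfa, hgb]⟩
  add_mem' := by
    rintro a b ⟨f, hf, hfa⟩ ⟨g, hg, hgb⟩
    exact ⟨fun w => f w + g w, hf.add hg, fun w => by simp [hfa, hgb]⟩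
  algebraMap_mem' c := ⟨fun _ => c, differentiable_const c, fun _ => rfl⟩

/-- The uniform closure on a closed ball of the algebra of entire functions. -/
def BallAlgebra (m : ℕ) (R : ℝ) : Type := (entireSubalgebra m R).topologicalClosure

noncomputable instance BallAlgebra.instNormedCommRing (R : ℝ) :
    NormedCommRing (BallAlgebra m R) :=
  { (inferInstance : NormedRing (entireSubalgebra m R).topologicalClosure) with
    mul_comm := fun a b => Subtype.ext (mul_comm a.1 b.1) }

noncomputable instance BallAlgebra.instNormedAlgebra (R : ℝ) :
    NormedAlgebra ℂ (BallAlgebra m R) :=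
  { (inferInstance : NormedAlgebra ℂ (entireSubalgebra m R).topologicalClosure) with }

instance BallAlgebra.instCompleteSpace (R : ℝ) : CompleteSpace (BallAlgebra m R) :=
  (Subalgebra.isClosed_topologicalClosure (entireSubalgebra m R)).completeSpace_coe

/-- The inclusion of `BallAlgebra` into the continuous functions. -/
def BallAlgebra.val (R : ℝ) :
    BallAlgebra m R →ₐ[ℂ] C(closedBall (0 : EuclideanSpace ℂ (Fin m)) R, ℂ) :=
  { toFun := fun a => a.1
    map_one' := rfl
    map_mul' := fun _ _ => rfl
    map_zero' := rfl
    map_add' := fun _ _ => rfl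
    commutes' := fun _ => rfl }

theorem BallAlgebra.ext_val {R : ℝ} {a b : BallAlgebra m R}
    (h : ∀ w, BallAlgebra.val R a w = BallAlgebra.val R b w) : a = b :=
  Subtype.ext (ContinuousMap.ext h)

theorem BallAlgebra.norm_val (R : ℝ) (a : BallAlgebra m R) : ‖BallAlgebra.val R a‖ = ‖a‖ := rfl

/-- The restriction of an entire function, as an element of `BallAlgebra`. -/
def entireRestrict (R : ℝ) (f : EuclideanSpace ℂ (Fin m) → ℂ) (hf : Differentiable ℂ f) :
    BallAlgebra m R :=
  ⟨⟨fun w => f w, hf.continuous.comp continuous_subtype_val⟩,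
    (entireSubalgebra m R).le_topologicalClosure ⟨f, hf, fun _ => rfl⟩⟩

theorem val_entireRestrict (R : ℝ) (f : EuclideanSpace ℂ (Fin m) → ℂ) (hf : Differentiable ℂ f)
    (w : closedBall (0 : EuclideanSpace ℂ (Fin m)) R) :
    BallAlgebra.val R (entireRestrict R f hf) w = f w := rfl

theorem norm_entireRestrict_le {R C : ℝ} (hC : 0 ≤ C) {f : EuclideanSpace ℂ (Fin m) → ℂ}
    (hf : Differentiable ℂ f) (h : ∀ w ∈ closedBall (0 : EuclideanSpace ℂ (Fin m)) R, ‖f w‖ ≤ C) :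
    ‖entireRestrict R f hf‖ ≤ C := by
  rw [← BallAlgebra.norm_val]
  exact (ContinuousMap.norm_le _ hC).2 fun w => h w w.2

/-- A function on the line satisfying a uniform local quadratic estimate is constant. -/
theorem eq_of_norm_sub_le_sq {φ : ℝ → ℂ} {C η : ℝ} (hη : 0 < η) 
    (h : ∀ s ∈ Icc (0 : ℝ) 1, ∀ t, |t - s| ≤ η → ‖φ t - φ s‖ ≤ C * |t - s| ^ 2) : φ 1 = φ 0 := by
  have hder : ∀ s ∈ Icc (0 : ℝ) 1, HasDerivAt φ 0 s := fun s hs => by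
    rw [hasDerivAt_iff_isLittleO]
    have hO : (fun t => φ t - φ s - (t - s) • (0 : ℂ)) =O[𝓝 s] fun t => (t - s) ^ 2 := by
      refine Asymptotics.IsBigO.of_bound C ?_
      filter_upwards [closedBall_mem_nhds s hη] with t ht
      simpa using h s hs t (by simpa [Real.dist_eq] using ht)
    refine hO.trans_isLittleO ?_
    have h1 : (fun t : ℝ => t - s) =o[𝓝 s] fun _ => (1 : ℝ) := by
      rw [Asymptotics.isLittleO_one_iff]
      have : Tendsto (fun t : ℝ => t - s) (𝓝 s) (𝓝 (s - s)) :=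
        (continuous_id.sub continuous_const).tendsto s
      simpa using this
    simpa [sq] using h1.mul_isBigO (Asymptotics.isBigO_refl (fun t : ℝ => t - s) (𝓝 s))
  refine constant_of_has_deriv_right_zero (a := (0 : ℝ)) (b := 1) ?_ ?_ 1 (by simp)
  · exact fun s hs => (hder s hs).continuousAt.continuousWithinAt
  · exact fun s hs => (hder s (Ico_subset_Icc_self hs)).hasDerivWithinAt

theorem norm_algHom_apply_le {R : ℝ} (χ : BallAlgebra m R →ₐ[ℂ] ℂ) (hR : 0 ≤ R)
    (a : BallAlgebra m R) : ‖χ a‖ ≤ ‖a‖ := by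
  have hne : Nonempty (closedBall (0 : EuclideanSpace ℂ (Fin m)) R) := ⟨⟨0, by simpa using hR⟩⟩
  have h1 : ‖(1 : BallAlgebra m R)‖ = 1 := by
    rw [← BallAlgebra.norm_val, map_one]
    exact norm_one
  simpa [h1] using AlgHom.norm_apply_le_self_mul_norm_one χ a

/-- Characters of `BallAlgebra` are point evaluations. -/
theorem algHom_entireRestrict {R : ℝ} (hR : 0 ≤ R) (χ : BallAlgebra m R →ₐ[ℂ] ℂ) :
    ∃ p ∈ closedBall (0 : EuclideanSpace ℂ (Fin m)) R,
      ∀ (f : EuclideanSpace ℂ (Fin m) → ℂ) (hf : Differentiable ℂ f),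
        χ (entireRestrict R f hf) = f p := by
  have hcoord : ∀ i, Differentiable ℂ fun w : EuclideanSpace ℂ (Fin m) => w i := fun i => by
    fun_prop
  let p : EuclideanSpace ℂ (Fin m) := WithLp.toLp 2 fun i => χ (entireRestrict R _ (hcoord i))
  have hp : ∀ i, χ (entireRestrict R _ (hcoord i)) = p i := fun i => rfl
  refine ⟨p, ?_, ?_⟩
  · have hl : Differentiable ℂ fun w : EuclideanSpace ℂ (Fin m) => inner ℂ p w :=
      (innerSL ℂ p).differentiable
    have h1 : χ (entireRestrict R _ hl) = (‖p‖ : ℂ) ^ 2 := by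
      have : entireRestrict R _ hl =
          ∑ i, (starRingEnd ℂ (p i)) • entireRestrict R _ (hcoord i) := by
        refine BallAlgebra.ext_val fun w => ?_
        simp [val_entireRestrict, PiLp.inner_apply, mul_comm]
      have hin := inner_self_eq_norm_sq_to_K (𝕜 := ℂ) p
      rw [PiLp.inner_apply] at hin
      rw [this, map_sum]
      refine Eq.trans ?_ hin
      exact Finset.sum_congr rfl fun i _ => by
        rw [map_smul, hp, RCLike.inner_apply, smul_eq_mul, mul_comm]
    have h2 := norm_algHom_apply_le χ hR (entireRestrict R _ hl)
    rw [h1] at h2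
    have h3 := h2.trans (norm_entireRestrict_le (C := ‖p‖ * R) (by positivity) hl fun w hw =>
      (norm_inner_le_norm p w).trans (by
        gcongr
        simpa using hw))
    rw [norm_pow, Complex.norm_real, norm_norm, sq] at h3
    rw [mem_closedBall_zero_iff]
    by_contra hlt
    push Not at hlt
    nlinarith
  · intro f hf
    have hfs : ∀ s : ℝ, Differentiable ℂ fun w => f (p + (s : ℂ) • (w - p)) := fun s =>
      hf.comp (((differentiable_id.sub_const p).const_smul (s : ℂ)).const_add p)
    let T : ℝ := R + ‖p‖ + 1
    have hT : 1 ≤ T := by simp only [T]; linarith [norm_nonneg p]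
    obtain ⟨C, hC0, hC⟩ := exists_norm_taylor_le hf (‖p‖ + T)
    have key := eq_of_norm_sub_le_sq (φ := fun s => χ (entireRestrict R _ (hfs s)))
      (C := C * T ^ 2 + m * (T * C)) (η := 1 / T) (by positivity) ?_
    · have e1 : entireRestrict R _ (hfs 1) = entireRestrict R f hf := by
        refine BallAlgebra.ext_val fun w => ?_
        simp [val_entireRestrict]
      have e0 : entireRestrict R _ (hfs 0) = algebraMap ℂ (BallAlgebra m R) (f p) := by
        refine BallAlgebra.ext_val fun w => ?_
        simp [val_entireRestrict]
      simp only [e1, e0, AlgHom.commutes] at key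
      simpa using key
    · intro s hs t hst
      set h : ℝ := t - s with hh
      have hts : t = s + h := by rw [hh]; ring
      have hq : ∀ i, Differentiable ℂ fun w => (w i - p i) *
          (f (p + (s : ℂ) • (w - p) + (h : ℂ) • EuclideanSpace.single i 1)
            - f (p + (s : ℂ) • (w - p))) := fun i =>
        ((hcoord i).sub_const _).mul ((hf.comp ((((differentiable_id.sub_const p).const_smul
          (s : ℂ)).const_add p).add_const _)).sub (hfs s))
      have hq0 : ∀ i, χ (entireRestrict R _ (hq i)) = 0 := fun i => by
        have hd : Differentiable ℂ fun w =>
          (f (p + (s : ℂ) • (w - p) + (h : ℂ) • EuclideanSpace.single i 1)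
            - f (p + (s : ℂ) • (w - p))) := ((hf.comp ((((differentiable_id.sub_const p).const_smul
          (s : ℂ)).const_add p).add_const _)).sub (hfs s))
        have : entireRestrict R _ (hq i) = (entireRestrict R _ (hcoord i)
          - algebraMap ℂ (BallAlgebra m R) (p i)) * entireRestrict R _ hd := by
          refine BallAlgebra.ext_val fun w => ?_
          simp [val_entireRestrict]
        rw [this, map_mul, map_sub, hp, AlgHom.commutes]
        simp
      have hr : Differentiable ℂ fun w => f (p + (t : ℂ) • (w - p)) - f (p + (s : ℂ) • (w - p))
          - ∑ i, (w i - p i) *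
          (f (p + (s : ℂ) • (w - p) + (h : ℂ) • EuclideanSpace.single i 1)
            - f (p + (s : ℂ) • (w - p))) :=
        ((hfs t).sub (hfs s)).sub (Differentiable.fun_sum fun i _ => hq i)
      have hdiff : χ (entireRestrict R _ (hfs t)) - χ (entireRestrict R _ (hfs s))
          = χ (entireRestrict R _ hr) := by
        have : entireRestrict R _ hr = entireRestrict R _ (hfs t) - entireRestrict R _ (hfs s)
            - ∑ i, entireRestrict R _ (hq i) := by
          refine BallAlgebra.ext_val fun w => ?_
          simp [val_entireRestrict]
        rw [this, map_sub, map_sub, map_sum, Finset.sum_eq_zero fun i _ => hq0 i, sub_zero]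
      simp only [hdiff]
      refine (norm_algHom_apply_le χ hR _).trans (norm_entireRestrict_le (by positivity) hr ?_)
      intro w hw
      rw [mem_closedBall_zero_iff] at hw
      have hwp : ‖w - p‖ ≤ T := (norm_sub_le _ _).trans (by simp only [T]; linarith)
      set a := p + (s : ℂ) • (w - p) with ha
      have haT : a ∈ closedBall (0 : EuclideanSpace ℂ (Fin m)) (‖p‖ + T) := by
        rw [mem_closedBall_zero_iff]
        refine (norm_add_le _ _).trans ?_
        gcongr
        rw [norm_smul, Complex.norm_real, Real.norm_eq_abs, abs_of_nonneg hs.1]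
        nlinarith [hs.2, norm_nonneg (w - p)]
      have hh1 : |h| ≤ 1 := hst.trans (by rw [div_le_one (by linarith)]; exact hT)
      have hv : ‖(h : ℂ) • (w - p)‖ ≤ |h| * T := by
        rw [norm_smul, Complex.norm_real, Real.norm_eq_abs]
        gcongr
      have hv1 : |h| * T ≤ 1 := by
        rwa [le_div_iff₀ (by linarith)] at hst
      have t1 := hC a haT ((h : ℂ) • (w - p)) (hv.trans hv1)
      have t2 : ∀ i : Fin m, ‖(w i - p i) * (f (a + (h : ℂ) • EuclideanSpace.single i 1) - f a
          - fderiv ℂ f a ((h : ℂ) • EuclideanSpace.single i 1))‖ ≤ T * (C * |h| ^ 2) := fun i => by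
        rw [norm_mul]
        have hn : ‖(h : ℂ) • (EuclideanSpace.single i 1 : EuclideanSpace ℂ (Fin m))‖ = |h| := by
          simp [norm_smul]
        have := hC a haT ((h : ℂ) • EuclideanSpace.single i 1) (hn.le.trans hh1)
        rw [hn] at this
        have hwi : ‖w i - p i‖ ≤ T := (PiLp.norm_apply_le (w - p) i).trans hwp
        gcongr
      have hlin : fderiv ℂ f a ((h : ℂ) • (w - p)) =
          ∑ i, (w i - p i) * fderiv ℂ f a ((h : ℂ) • EuclideanSpace.single i 1) := by
        have : w - p = ∑ i, (w i - p i) • (EuclideanSpace.single i 1 : EuclideanSpace ℂ (Fin m)) := by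
          ext j
          simp [Pi.single_apply]
        conv_lhs => rw [this]
        simp only [Finset.smul_sum, map_sum, map_smul, smul_eq_mul]
        exact Finset.sum_congr rfl fun i _ => by ring
      have hta : p + (t : ℂ) • (w - p) = a + (h : ℂ) • (w - p) := by
        rw [ha, hts]
        push_cast
        rw [add_smul, add_assoc]
      rw [hta]
      calc _ = ‖(f (a + (h : ℂ) • (w - p)) - f a - fderiv ℂ f a ((h : ℂ) • (w - p)))
            - ∑ i, (w i - p i) * (f (a + (h : ℂ) • EuclideanSpace.single i 1) - f a
          - fderiv ℂ f a ((h : ℂ) • EuclideanSpace.single i 1))‖ := by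
            rw [hlin]
            simp only [mul_sub, Finset.sum_sub_distrib]
            congr 1
            ring
        _ ≤ C * (|h| * T) ^ 2 + ∑ i : Fin m, T * (C * |h| ^ 2) := by
            refine (norm_sub_le _ _).trans (add_le_add (t1.trans ?_) ((norm_sum_le _ _).trans
              (Finset.sum_le_sum fun i _ => t2 i)))
            gcongr
        _ = _ := by
            simp only [Finset.sum_const, Finset.card_univ, Fintype.card_fin, nsmul_eq_mul]
            ring

/-- Approximate Bézout identities with entire coefficients on a closed ball. -/
theorem exists_entire_bezout {ι : Type*} {R : ℝ} (hR : 0 ≤ R)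
    {h : ι → EuclideanSpace ℂ (Fin m) → ℂ} (hh : ∀ i, Differentiable ℂ (h i))
    (hz : ∀ w ∈ closedBall (0 : EuclideanSpace ℂ (Fin m)) R, ∃ i, h i w ≠ 0) :
    ∃ (S : Finset ι) (B : ℝ), ∀ ε > 0, ∃ α : ι → EuclideanSpace ℂ (Fin m) → ℂ,
      (∀ i, Differentiable ℂ (α i)) ∧
      (∀ i ∈ S, ∀ w ∈ closedBall (0 : EuclideanSpace ℂ (Fin m)) R, ‖α i w‖ ≤ B) ∧
      ∀ w ∈ closedBall (0 : EuclideanSpace ℂ (Fin m)) R,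
        ‖∑ i ∈ S, α i w * h i w - 1‖ ≤ ε := by
  let H : ι → BallAlgebra m R := fun i => entireRestrict R (h i) (hh i)
  have htop : Ideal.span (range H) = ⊤ := by
    by_contra hne
    obtain ⟨M, hM, hle⟩ := Ideal.exists_le_maximal _ hne
    obtain ⟨p, hp, hχ⟩ := algHom_entireRestrict hR
      (WeakDual.CharacterSpace.toAlgHom M.toCharacterSpace)
    obtain ⟨i, hi⟩ := hz p hp
    apply hi
    rw [← hχ (h i) (hh i)]
    exact M.toCharacterSpace_apply_eq_zero_of_mem (hle (Ideal.subset_span ⟨i, rfl⟩))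
  obtain ⟨c, hc⟩ := (Finsupp.mem_ideal_span_range_iff_exists_finsupp).1
    ((Ideal.eq_top_iff_one _).1 htop)
  refine ⟨c.support, ∑ i ∈ c.support, ‖c i‖ + 1, fun ε hε => ?_⟩
  obtain ⟨D, hD0, hD⟩ : ∃ D : ℝ, 0 < D ∧ ∑ i ∈ c.support, ‖H i‖ ≤ D :=
    ⟨∑ i ∈ c.support, ‖H i‖ + 1, by positivity, by linarith⟩
  have happ : ∀ i, ∃ α : EuclideanSpace ℂ (Fin m) → ℂ, ∃ hα : Differentiable ℂ α,
      ‖entireRestrict R α hα - c i‖ ≤ min 1 (ε / D) := fun i => by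
    have hmem : BallAlgebra.val R (c i) ∈
      closure (entireSubalgebra m R : Set _) := (c i).2
    obtain ⟨g, ⟨α, hα, hg⟩, hdist⟩ := Metric.mem_closure_iff.1 hmem (min 1 (ε / D)) (by positivity)
    refine ⟨α, hα, ?_⟩
    rw [dist_comm, dist_eq_norm] at hdist
    have : g = BallAlgebra.val R (entireRestrict R α hα) := by
      ext w
      exact hg w
    rw [this, ← map_sub, BallAlgebra.norm_val] at hdist
    exact hdist.le
  choose α hα hαc using happ
  have hpt : ∀ (a : BallAlgebra m R) (w : closedBall (0 : EuclideanSpace ℂ (Fin m)) R),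
      ‖BallAlgebra.val R a w‖ ≤ ‖a‖ := fun a w =>
    ContinuousMap.norm_coe_le_norm (BallAlgebra.val R a) w
  refine ⟨α, hα, fun i hi w hw => ?_, fun w hw => ?_⟩
  · have h1 := hpt (entireRestrict R (α i) (hα i)) ⟨w, hw⟩
    refine h1.trans ?_
    have h2 := norm_le_norm_add_norm_sub (c i) (entireRestrict R (α i) (hα i))
    rw [norm_sub_rev] at h2
    have h3 := Finset.single_le_sum (f := fun i => ‖c i‖) (fun j _ => norm_nonneg _) hi
    have h4 := (hαc i).trans (min_le_left _ _)
    linarith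
  · have hone : ∑ i ∈ c.support, entireRestrict R (α i) (hα i) * H i - 1
        = ∑ i ∈ c.support, (entireRestrict R (α i) (hα i) - c i) * H i := by
      simp only [sub_mul]
      rw [← hc, Finsupp.sum]
      exact (Finset.sum_sub_distrib _ _).symm
    have hval : BallAlgebra.val R
        (∑ i ∈ c.support, entireRestrict R (α i) (hα i) * H i - 1) ⟨w, hw⟩ = ∑ i ∈ c.support, α i w * h i w - 1 := by
      simp [val_entireRestrict, H]
    rw [← hval]
    refine (hpt _ _).trans ?_
    rw [hone]
    calc _ ≤ ∑ i ∈ c.support, ‖(entireRestrict R (α i) (hα i) - c i) * H i‖ := norm_sum_le _ _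
      _ ≤ ∑ i ∈ c.support, ε / D * ‖H i‖ := Finset.sum_le_sum fun i _ =>
          (norm_mul_le _ _).trans (by
            gcongr
            exact (hαc i).trans (min_le_right _ _))
      _ = ε / D * ∑ i ∈ c.support, ‖H i‖ := by rw [Finset.mul_sum]
      _ ≤ ε / D * D := by gcongr
      _ = ε := by field_simp

end Bezout

section Shear

variable {ι X : Type*} [Fintype ι] [DecidableEq ι] [NormedAddCommGroup X] [NormedSpace ℂ X]

/-- The `k`-th factor of `sepDet`. -/
noncomputable def sepFactor (l : X →L[ℂ] ℂ) (y : ι → X) (k : ι) : ℂ :=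
  ∏ j ∈ Finset.univ.erase k, (l (y k) - l (y j))

/-- The product of all differences `l (y k) - l (y j)`, `j ≠ k`; it is nonzero exactly when `l`
separates the points of `y`. -/
noncomputable def sepDet (l : X →L[ℂ] ℂ) (y : ι → X) : ℂ := ∏ k, sepFactor l y k

/-- The scalar coefficients of `shearVec`. -/
noncomputable def shearCoeff (l : X →L[ℂ] ℂ) (y : ι → X) (z : X) (i : ι) : ℂ :=
  (∏ k ∈ Finset.univ.erase i, sepFactor l y k) * ∏ j ∈ Finset.univ.erase i, (l z - l (y j))

/-- Lagrange interpolation along `l`, with cleared denominators: the displacement at a point `z`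
depends only on `l z`, and equals `sepDet l y • d i` at `z = y i`. -/
noncomputable def shearVec (l : X →L[ℂ] ℂ) (y d : ι → X) (z : X) : X := ∑ i, shearCoeff l y z i • d i

theorem sepDet_ne_zero {l : X →L[ℂ] ℂ} {y : ι → X} (h : ∀ i j, i ≠ j → l (y i) ≠ l (y j)) :
    sepDet l y ≠ 0 :=
  Finset.prod_ne_zero_iff.2 fun k _ => Finset.prod_ne_zero_iff.2 fun j hj =>
    sub_ne_zero.2 (h k j (Finset.ne_of_mem_erase hj).symm)

theorem shearVec_congr (l : X →L[ℂ] ℂ) (y d : ι → X) {z z' : X} (h : l z = l z') :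
    shearVec l y d z = shearVec l y d z' := by
  simp only [shearVec, shearCoeff, h]

theorem apply_shearVec {l : X →L[ℂ] ℂ} {d : ι → X} (hd : ∀ i, l (d i) = 0) (y : ι → X) (z : X) :
    l (shearVec l y d z) = 0 := by
  simp [shearVec, hd]

theorem shearVec_self (l : X →L[ℂ] ℂ) (y d : ι → X) (i : ι) :
    shearVec l y d (y i) = sepDet l y • d i := by
  rw [shearVec, Finset.sum_eq_single i]
  · congr 1
    rw [shearCoeff, sepDet, mul_comm]
    exact Finset.mul_prod_erase Finset.univ (sepFactor l y) (Finset.mem_univ i)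
  · intro j _ hj
    have h0 : ∏ k ∈ Finset.univ.erase j, (l (y i) - l (y k)) = 0 :=
      Finset.prod_eq_zero (Finset.mem_erase.2 ⟨hj.symm, Finset.mem_univ i⟩) (sub_self _)
    rw [shearCoeff, h0, mul_zero, zero_smul]
  · simp

theorem shearVec_zero (l : X →L[ℂ] ℂ) (y : ι → X) (z : X) : shearVec l y 0 z = 0 := by
  simp [shearVec]

theorem differentiable_sepFactor (l : X →L[ℂ] ℂ) (k : ι) :
    Differentiable ℂ fun y : ι → X => sepFactor l y k := by
  unfold sepFactor
  fun_prop

theorem differentiable_sepDet (l : X →L[ℂ] ℂ) : Differentiable ℂ (sepDet l : (ι → X) → ℂ) := by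
  have h := differentiable_sepFactor (ι := ι) l
  unfold sepDet
  fun_prop

theorem differentiable_shearCoeff (l : X →L[ℂ] ℂ) (i : ι) :
    Differentiable ℂ fun p : (ι → X) × X => shearCoeff l p.1 p.2 i := by
  have h : ∀ k, Differentiable ℂ fun p : (ι → X) × X => sepFactor l p.1 k := fun k =>
    (differentiable_sepFactor l k).comp differentiable_fst
  unfold shearCoeff
  fun_prop

theorem Differentiable.shearVec {Y : Type*} [NormedAddCommGroup Y] [NormedSpace ℂ Y]
    (l : X →L[ℂ] ℂ) {y d : Y → ι → X} {z : Y → X} (hy : Differentiable ℂ y)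
    (hd : Differentiable ℂ d) (hz : Differentiable ℂ z) :
    Differentiable ℂ fun p => shearVec l (y p) (d p) (z p) := by
  unfold _root_.shearVec
  refine Differentiable.fun_sum fun i _ => ?_
  exact ((differentiable_shearCoeff l i).comp (hy.prodMk hz)).smul (differentiable_pi.1 hd i)

theorem exists_norm_shearVec_le [ProperSpace X] (l : X →L[ℂ] ℂ) (ρ : ℝ) :
    ∃ Γ : ℝ, 0 ≤ Γ ∧ ∀ y d : ι → X, ∀ z : X, ‖y‖ ≤ ρ → ‖z‖ ≤ ρ →
      ‖shearVec l y d z‖ ≤ Γ * ‖d‖ := by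
  have h : ∀ i : ι, ∃ C : ℝ, ∀ p ∈ closedBall (0 : (ι → X) × X) ρ, ‖shearCoeff l p.1 p.2 i‖ ≤ C :=
    fun i => (isCompact_closedBall _ _).exists_bound_of_continuousOn
      (differentiable_shearCoeff l i).continuous.continuousOn
  choose C hC using h
  refine ⟨∑ i, max (C i) 0, Finset.sum_nonneg fun i _ => le_max_right _ _,
    fun y d z hy hz => ?_⟩
  rw [shearVec, Finset.sum_mul]
  refine (norm_sum_le _ _).trans (Finset.sum_le_sum fun i _ => ?_)
  rw [norm_smul]
  gcongr
  · exact (hC i (y, z) (by simpa [Prod.norm_def] using ⟨hy, hz⟩)).trans (le_max_left _ _)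
  · exact norm_le_pi_norm d i

/-- Entire functions on finite-dimensional spaces are Lipschitz on balls. -/
theorem exists_lipschitz_closedBall {E F : Type*} [NormedAddCommGroup E] [NormedSpace ℂ E]
    [ProperSpace E] [NormedAddCommGroup F] [NormedSpace ℂ F] {f : E → F}
    (hf : Differentiable ℂ f) (ρ : ℝ) :
    ∃ C : ℝ, 0 ≤ C ∧ ∀ a b : E, ‖a‖ ≤ ρ → ‖b‖ ≤ ρ → ‖f a - f b‖ ≤ C * ‖a - b‖ := by
  obtain ⟨C, hC⟩ := (isCompact_closedBall (0 : E) (ρ + 1)).exists_bound_of_continuousOn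
    hf.continuous.continuousOn
  refine ⟨max C 0, le_max_right _ _, fun a b ha hb => ?_⟩
  refine (convex_closedBall (0 : E) ρ).norm_image_sub_le_of_norm_fderiv_le (𝕜 := ℂ)
    (fun u _ => hf u) (fun u hu => ?_) (by simpa using hb) (by simpa using ha)
  have := norm_fderiv_le_of_closedBall (f := f) (x := u) one_pos (le_max_right C 0)
    (fun z _ => hf z) (fun z hz => (hC z ?_).trans (le_max_left _ _))
  · simpa using this
  · rw [mem_closedBall_zero_iff] at hu ⊢
    rw [mem_closedBall_iff_norm'] at hz
    linarith [norm_le_norm_add_norm_sub u z]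

end Shear

section Families

variable {W X : Type*} [NormedAddCommGroup W] [NormedSpace ℂ W]
  [NormedAddCommGroup X] [NormedSpace ℂ X]

/-- A holomorphic family, parametrized by `W`, of holomorphic automorphisms of `X`. -/
structure AutFamily (W X : Type*) [NormedAddCommGroup W] [NormedSpace ℂ W]
    [NormedAddCommGroup X] [NormedSpace ℂ X] where
  /-- The automorphisms. -/
  toFun : W → X → X
  /-- The inverse automorphisms. -/
  inv : W → X → X
  differentiable_toFun : Differentiable ℂ fun p : W × X => toFun p.1 p.2
  differentiable_inv : Differentiable ℂ fun p : W × X => inv p.1 p.2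
  left_inv : ∀ w z, inv w (toFun w z) = z
  right_inv : ∀ w z, toFun w (inv w z) = z

namespace AutFamily

/-- The constant family `id`. -/
protected def id : AutFamily W X where
  toFun _ z := z
  inv _ z := z
  differentiable_toFun := differentiable_snd
  differentiable_inv := differentiable_snd
  left_inv _ _ := rfl
  right_inv _ _ := rfl

/-- Fibrewise composition. -/
def comp (g f : AutFamily W X) : AutFamily W X where
  toFun w z := g.toFun w (f.toFun w z)
  inv w z := f.inv w (g.inv w z)
  differentiable_toFun :=
    g.differentiable_toFun.comp (differentiable_fst.prodMk f.differentiable_toFun)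
  differentiable_inv :=
    f.differentiable_inv.comp (differentiable_fst.prodMk g.differentiable_inv)
  left_inv w z := by rw [g.left_inv, f.left_inv]
  right_inv w z := by rw [f.right_inv, g.right_inv]

/-- The family of shears attached to moving configurations `y w` and directions `d w`. -/
noncomputable def shear {ι : Type*} [Fintype ι] [DecidableEq ι] (l : X →L[ℂ] ℂ) (y d : W → ι → X)
    (hy : Differentiable ℂ y) (hd : Differentiable ℂ d) (hl : ∀ w i, l (d w i) = 0) :
    AutFamily W X where
  toFun w z := z + shearVec l (y w) (d w) z
  inv w z := z - shearVec l (y w) (d w) z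
  differentiable_toFun := differentiable_snd.add (Differentiable.shearVec l
    (hy.comp differentiable_fst) (hd.comp differentiable_fst) differentiable_snd)
  differentiable_inv := differentiable_snd.sub (Differentiable.shearVec l
    (hy.comp differentiable_fst) (hd.comp differentiable_fst) differentiable_snd)
  left_inv w z := by
    rw [shearVec_congr l (y w) (d w) (z := z + shearVec l (y w) (d w) z) (z' := z)
      (by simp [apply_shearVec (hl w)])]
    simp
  right_inv w z := by
    rw [shearVec_congr l (y w) (d w) (z := z - shearVec l (y w) (d w) z) (z' := z)
      (by simp [apply_shearVec (hl w)])]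
    simp

theorem injective (f : AutFamily W X) (w : W) : Function.Injective (f.toFun w) :=
  Function.LeftInverse.injective (f.left_inv w)

/-- The motion of a moving configuration under a family. -/
theorem differentiable_config {ι : Type*} [Fintype ι] (f : AutFamily W X) {y : W → ι → X}
    (hy : Differentiable ℂ y) : Differentiable ℂ fun w i => f.toFun w (y w i) :=
  differentiable_pi.2 fun i =>
    f.differentiable_toFun.comp (differentiable_id.prodMk (differentiable_pi.1 hy i))

/-- At the parameter `w`, the family and its inverse move points by at most `D`, as long as the
points keep a distance `D` from the complement of the ball of radius `ρ`. -/
def NearId (f : AutFamily W X) (w : W) (ρ D : ℝ) : Prop :=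
  ∀ z, ‖z‖ + D ≤ ρ → ‖f.toFun w z - z‖ ≤ D ∧ ‖f.inv w z - z‖ ≤ D

theorem NearId.mono {f : AutFamily W X} {w : W} {ρ D D' : ℝ} (h : f.NearId w ρ D) (hD : D ≤ D') :
    f.NearId w ρ D' := fun z hz =>
  ⟨(h z (by linarith)).1.trans hD, (h z (by linarith)).2.trans hD⟩

theorem nearId_id (w : W) (ρ : ℝ) : (AutFamily.id : AutFamily W X).NearId w ρ 0 := fun z _ => by
  simp [AutFamily.id]

theorem NearId.comp {g f : AutFamily W X} {w : W} {ρ D D' : ℝ} (hg : g.NearId w ρ D')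
    (hf : f.NearId w ρ D) (hD : 0 ≤ D) (hD' : 0 ≤ D') : (g.comp f).NearId w ρ (D + D') := by
  intro z hz
  have h1 := (hf z (by linarith)).1
  have h2 := (hg z (by linarith)).2
  have n1 := norm_le_norm_add_norm_sub z (f.toFun w z)
  have n2 := norm_le_norm_add_norm_sub z (g.inv w z)
  rw [norm_sub_rev] at n1 n2
  have h3 := (hg (f.toFun w z) (by linarith)).1
  have h4 := (hf (g.inv w z) (by linarith)).2
  constructor
  · calc _ = ‖(g.toFun w (f.toFun w z) - f.toFun w z) + (f.toFun w z - z)‖ := by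
          simp [AutFamily.comp]
      _ ≤ D' + D := (norm_add_le _ _).trans (by linarith)
      _ = _ := add_comm _ _
  · calc _ = ‖(f.inv w (g.inv w z) - g.inv w z) + (g.inv w z - z)‖ := by
          simp [AutFamily.comp]
      _ ≤ D + D' := (norm_add_le _ _).trans (by linarith)

theorem nearId_shear {ι : Type*} [Fintype ι] [DecidableEq ι] {l : X →L[ℂ] ℂ} {y d : W → ι → X}
    (hy : Differentiable ℂ y) (hd : Differentiable ℂ d) (hl : ∀ w i, l (d w i) = 0) {w : W}
    {ρ D : ℝ} (hD : 0 ≤ D) (h : ∀ z, ‖z‖ ≤ ρ → ‖shearVec l (y w) (d w) z‖ ≤ D) :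
    (shear l y d hy hd hl).NearId w ρ D := fun z hz => by
  have := h z (by linarith)
  simpa [shear] using this

end AutFamily

end Families

section Moves

variable {ι W X : Type*} [Fintype ι] [DecidableEq ι] [NormedAddCommGroup W] [NormedSpace ℂ W]
  [NormedAddCommGroup X] [NormedSpace ℂ X]

/-- A direction, depending holomorphically on the parameter, for moving configurations by shears
along a linear form. -/
structure Move (ι W X : Type*) [Fintype ι] [NormedAddCommGroup W] [NormedSpace ℂ W]
    [NormedAddCommGroup X] [NormedSpace ℂ X] where
  /-- The linear form constant along the move. -/
  lam : X →L[ℂ] ℂ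
  /-- The direction. -/
  dir : W → ι → X
  differentiable_dir : Differentiable ℂ dir
  lam_dir : ∀ w i, lam (dir w i) = 0

/-- The effect of a move on configurations. -/
noncomputable def Move.shift (t : Move ι W X) (w : W) (z : ι → X) : ι → X :=
  z + sepDet t.lam z • t.dir w

/-- The effect of a list of moves on configurations. -/
noncomputable def moveConfig (L : List (Move ι W X)) (w : W) (z : ι → X) : ι → X :=
  L.foldl (fun z t => t.shift w z) z

theorem moveConfig_cons (t : Move ι W X) (L : List (Move ι W X)) (w : W) (z : ι → X) :
    moveConfig (t :: L) w z = moveConfig L w (t.shift w z) := rfl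

theorem moveConfig_append (L L' : List (Move ι W X)) (w : W) (z : ι → X) :
    moveConfig (L ++ L') w z = moveConfig L' w (moveConfig L w z) := by
  simp [moveConfig]

/-- Moves of configurations are realized by families of automorphisms. -/
theorem exists_autFamily_moveConfig (L : List (Move ι W X)) {y : W → ι → X}
    (hy : Differentiable ℂ y) :
    ∃ g : AutFamily W X, (∀ w i, g.toFun w (y w i) = moveConfig L w (y w) i) ∧
      ∀ (w : W) (ρ : ℝ) (Γ : (X →L[ℂ] ℂ) → ℝ), (∀ l, 0 ≤ Γ l) →
        (∀ l, ∀ y d : ι → X, ∀ z, ‖y‖ ≤ ρ → ‖z‖ ≤ ρ → ‖shearVec l y d z‖ ≤ Γ l * ‖d‖) →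
        ‖y w‖ + (L.map fun t => Γ t.lam * ‖t.dir w‖).sum ≤ ρ →
        g.NearId w ρ (L.map fun t => Γ t.lam * ‖t.dir w‖).sum := by
  induction L generalizing y with
  | nil =>
    exact ⟨AutFamily.id, fun w i => rfl, fun w ρ Γ _ _ _ => by
      simpa using AutFamily.nearId_id w ρ⟩
  | cons t L ih =>
    let s := AutFamily.shear t.lam y t.dir hy t.differentiable_dir t.lam_dir
    have hs : ∀ w, (fun i => s.toFun w (y w i)) = t.shift w (y w) := fun w => by
      funext i
      simp [s, AutFamily.shear, Move.shift, shearVec_self]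
    obtain ⟨g, hg, hnear⟩ := ih (s.differentiable_config hy)
    refine ⟨g.comp s, fun w i => ?_, fun w ρ Γ hΓ0 hΓ hsum => ?_⟩
    · have := hg w i
      rw [hs w] at this
      exact this
    · simp only [List.map_cons, List.sum_cons] at hsum ⊢
      have hS : 0 ≤ (L.map fun t => Γ t.lam * ‖t.dir w‖).sum := by
        refine List.sum_nonneg fun a ha => ?_
        obtain ⟨t, _, rfl⟩ := List.mem_map.1 ha
        exact mul_nonneg (hΓ0 _) (norm_nonneg _)
      have hD : 0 ≤ Γ t.lam * ‖t.dir w‖ := mul_nonneg (hΓ0 _) (norm_nonneg _)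
      have hsn : s.NearId w ρ (Γ t.lam * ‖t.dir w‖) :=
        AutFamily.nearId_shear _ _ _ hD fun z hz => hΓ _ _ _ _ (by linarith) hz
      refine (hnear w ρ Γ hΓ0 hΓ ?_).comp hsn hD hS
      have : ‖fun i => s.toFun w (y w i)‖ ≤ ‖y w‖ + Γ t.lam * ‖t.dir w‖ := by
        refine (pi_norm_le_iff_of_nonneg (by positivity)).2 fun i => ?_
        have h1 := norm_le_pi_norm (y w) i
        have h2 := (hsn (y w i) (by linarith)).1
        have h3 := norm_le_norm_add_norm_sub (y w i) (s.toFun w (y w i))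
        rw [norm_sub_rev] at h3
        linarith
      linarith

/-- To first order, a list of moves translates configurations. -/
theorem norm_moveConfig_sub_le (L : List (Move ι W X)) {w : W} {y z : ι → X} {A C M : ℝ}
    (hA0 : 0 ≤ A) (hC0 : 0 ≤ C)
    (hA : ∀ t ∈ L, ∀ a : ι → X, ‖a‖ ≤ M → ‖sepDet t.lam a‖ ≤ A)
    (hC : ∀ t ∈ L, ∀ a b : ι → X, ‖a‖ ≤ M → ‖b‖ ≤ M →
      ‖sepDet t.lam a - sepDet t.lam b‖ ≤ C * ‖a - b‖)
    (hy : ‖y‖ + 1 ≤ M) (hz : ‖z - y‖ + A * (L.map fun t => ‖t.dir w‖).sum ≤ 1) :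
    ‖moveConfig L w z - z - (L.map fun t => sepDet t.lam y • t.dir w).sum‖ ≤
      C * (‖z - y‖ + A * (L.map fun t => ‖t.dir w‖).sum) * (L.map fun t => ‖t.dir w‖).sum := by
  induction L generalizing z with
  | nil => simp [moveConfig]
  | cons t L ih =>
    simp only [List.map_cons, List.sum_cons, List.forall_mem_cons] at *
    have hS : 0 ≤ (L.map fun t => ‖t.dir w‖).sum := by
      refine List.sum_nonneg fun a ha => ?_
      obtain ⟨t, _, rfl⟩ := List.mem_map.1 ha
      exact norm_nonneg _
    set σ := (L.map fun t => ‖t.dir w‖).sum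
    set z' := t.shift w z with hz'
    have hzM : ‖z‖ ≤ M := by
      have := norm_le_norm_add_norm_sub y z
      rw [norm_sub_rev] at this
      have h1 : 0 ≤ A * (‖t.dir w‖ + σ) := by positivity
      linarith
    have hyM : ‖y‖ ≤ M := by linarith
    have hzz : z' - z = sepDet t.lam z • t.dir w := by simp [hz', Move.shift]
    have hd : ‖z' - y‖ ≤ ‖z - y‖ + A * ‖t.dir w‖ := by
      calc ‖z' - y‖ = ‖(z - y) + (z' - z)‖ := by congr 1; abel
        _ ≤ ‖z - y‖ + ‖z' - z‖ := norm_add_le _ _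
        _ ≤ _ := by
          rw [hzz, norm_smul]
          gcongr
          exact hA.1 z hzM
    have h1 := ih hA.2 hC.2 (z := z') (by linarith)
    have h2 : ‖(sepDet t.lam z - sepDet t.lam y) • t.dir w‖ ≤ C * ‖z - y‖ * ‖t.dir w‖ := by
      rw [norm_smul]
      gcongr
      exact hC.1 z y hzM hyM
    rw [moveConfig_cons, ← hz']
    calc _ = ‖(moveConfig L w z' - z' - (L.map fun t => sepDet t.lam y • t.dir w).sum)
          + (sepDet t.lam z - sepDet t.lam y) • t.dir w‖ := by
            congr 1
            rw [sub_smul, ← hzz]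
            abel
      _ ≤ C * (‖z' - y‖ + A * σ) * σ + C * ‖z - y‖ * ‖t.dir w‖ :=
            (norm_add_le _ _).trans (add_le_add h1 h2)
      _ ≤ C * (‖z - y‖ + A * ‖t.dir w‖ + A * σ) * σ
          + C * (‖z - y‖ + A * ‖t.dir w‖ + A * σ) * ‖t.dir w‖ := by
            gcongr
            have : 0 ≤ A * ‖t.dir w‖ + A * σ := by positivity
            linarith
      _ = _ := by ring

end Moves

section Pairs

variable {ι X : Type*} [Fintype ι] [DecidableEq ι] [NormedAddCommGroup X] [NormedSpace ℂ X]

/-- Two linear forms together with a vector on which they take the values `1` and `0`. -/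
structure FormPair (X : Type*) [NormedAddCommGroup X] [NormedSpace ℂ X] where
  /-- The first form. -/
  lam : X →L[ℂ] ℂ
  /-- The second form. -/
  mu : X →L[ℂ] ℂ
  /-- The vector. -/
  vec : X
  lam_vec : lam vec = 1
  mu_vec : mu vec = 0

namespace FormPair

/-- The projection onto the kernel of `lam` along `vec`. -/
noncomputable def projLam (c : FormPair X) : X →L[ℂ] X :=
  ContinuousLinearMap.id ℂ X - c.lam.smulRight c.vec

/-- The projection onto the span of `vec` along the kernel of `lam`. -/
noncomputable def projVec (c : FormPair X) : X →L[ℂ] X := c.lam.smulRight c.vec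

theorem lam_projLam (c : FormPair X) (v : X) : c.lam (c.projLam v) = 0 := by
  simp [projLam, c.lam_vec]

theorem mu_projVec (c : FormPair X) (v : X) : c.mu (c.projVec v) = 0 := by
  simp [projVec, c.mu_vec]

theorem projLam_add_projVec (c : FormPair X) (v : X) : c.projLam v + c.projVec v = v := by
  simp [projLam, projVec]

/-- The product of the functions `sepDet` of the two forms. -/
noncomputable def det (c : FormPair X) (y : ι → X) : ℂ := sepDet c.lam y * sepDet c.mu y

theorem differentiable_det (c : FormPair X) : Differentiable ℂ (c.det : (ι → X) → ℂ) :=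
  (differentiable_sepDet c.lam).mul (differentiable_sepDet c.mu)

/-- There are pairs of forms not vanishing on finitely many given nonzero vectors. -/
theorem exists_forall_ne_zero [FiniteDimensional ℂ X] (hX : 2 ≤ Module.finrank ℂ X)
    {κ : Type*} [Finite κ] (v : κ → X) (hv : ∀ k, v k ≠ 0) :
    ∃ c : FormPair X, ∀ k, c.lam (v k) ≠ 0 ∧ c.mu (v k) ≠ 0 := by
  obtain ⟨μ, hμ⟩ := Module.exists_dual_forall_apply_ne_zero (K := ℂ) v hv
  have hker : LinearMap.ker μ ≠ ⊥ := LinearMap.ker_ne_bot_of_finrank_lt (by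
    rw [Module.finrank_self]
    omega)
  obtain ⟨u, hu, hu0⟩ := Submodule.exists_mem_ne_zero_of_ne_bot hker
  obtain ⟨l, hl⟩ := Module.exists_dual_forall_apply_ne_zero (K := ℂ)
    (fun k : Option κ => k.elim u v) (by
      rintro (_ | k)
      · exact hu0
      · exact hv k)
  have hlu : l u ≠ 0 := hl none
  exact ⟨⟨LinearMap.toContinuousLinearMap l, LinearMap.toContinuousLinearMap μ, (l u)⁻¹ • u,
    by simp [hlu], by simp [LinearMap.mem_ker.1 hu]⟩, fun k => ⟨hl (some k), hμ k⟩⟩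

theorem exists_det_ne_zero [FiniteDimensional ℂ X] (hX : 2 ≤ Module.finrank ℂ X) {y y' : ι → X}
    (hy : Function.Injective y) (hy' : Function.Injective y') :
    ∃ c : FormPair X, c.det y ≠ 0 ∧ c.det y' ≠ 0 := by
  obtain ⟨c, hc⟩ := exists_forall_ne_zero hX
    (fun k : {p : ι × ι // p.1 ≠ p.2} × Bool =>
      cond k.2 (y k.1.1.1 - y k.1.1.2) (y' k.1.1.1 - y' k.1.1.2))
    (by
      rintro ⟨k, _ | _⟩
      · exact sub_ne_zero.2 fun h => k.2 (hy' h)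
      · exact sub_ne_zero.2 fun h => k.2 (hy h))
  have h : ∀ i j, i ≠ j → (c.lam (y i) ≠ c.lam (y j) ∧ c.mu (y i) ≠ c.mu (y j)) ∧
      (c.lam (y' i) ≠ c.lam (y' j) ∧ c.mu (y' i) ≠ c.mu (y' j)) := fun i j hij => by
    have h1 := hc (⟨(i, j), hij⟩, true)
    have h2 := hc (⟨(i, j), hij⟩, false)
    simp only [cond_true, cond_false, map_sub, sub_ne_zero] at h1 h2
    exact ⟨h1, h2⟩
  exact ⟨c, mul_ne_zero (sepDet_ne_zero fun i j hij => (h i j hij).1.1)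
      (sepDet_ne_zero fun i j hij => (h i j hij).1.2),
    mul_ne_zero (sepDet_ne_zero fun i j hij => (h i j hij).2.1)
      (sepDet_ne_zero fun i j hij => (h i j hij).2.2)⟩

end FormPair

end Pairs

section Euler

variable {ι W X : Type*} [Fintype ι] [NormedAddCommGroup W] [NormedSpace ℂ W]
  [NormedAddCommGroup X]

/-- The displacement of a configuration between two times. -/
noncomputable def radialDiff (y : W → ι → X) (s s' : ℝ) (w : W) : ι → X := y (s' • w) - y (s • w)

theorem one_sub_div_mem_Icc {k p : ℕ} (h : k ≤ p) : (1 - k / p : ℝ) ∈ Icc (0 : ℝ) 1 := by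
  have : (k : ℝ) ≤ p := by exact_mod_cast h
  have h1 : (k / p : ℝ) ≤ 1 := div_le_one_of_le₀ this (by positivity)
  have h2 : (0 : ℝ) ≤ k / p := by positivity
  exact ⟨by linarith, by linarith⟩

theorem norm_radialDiff_le {y : W → ι → X} {w : W} {Λ : ℝ} {p k : ℕ} (hk : k + 1 ≤ p)
    (hΛ : ∀ s ∈ Icc (0 : ℝ) 1, ∀ s' ∈ Icc (0 : ℝ) 1, ‖y (s' • w) - y (s • w)‖ ≤ Λ * |s' - s|) :
    ‖radialDiff y (1 - k / p) (1 - (k + 1 : ℕ) / p) w‖ ≤ Λ / p := by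
  refine (hΛ _ (one_sub_div_mem_Icc (by omega)) _ (one_sub_div_mem_Icc hk)).trans (le_of_eq ?_)
  have : (1 - (k + 1 : ℕ) / p - (1 - k / p) : ℝ) = -(1 / p) := by
    push_cast
    ring
  rw [this, abs_neg, abs_of_nonneg (by positivity)]
  ring

variable [NormedSpace ℂ X]

theorem differentiable_comp_real_smul {F : Type*} [NormedAddCommGroup F] [NormedSpace ℂ F]
    {f : W → F} (hf : Differentiable ℂ f) (s : ℝ) : Differentiable ℂ fun w => f (s • w) :=
  hf.comp (differentiable_id.const_smul s)

theorem differentiable_radialDiff {y : W → ι → X} (hy : Differentiable ℂ y) (s s' : ℝ) :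
    Differentiable ℂ (radialDiff y s s') :=
  (differentiable_comp_real_smul hy s').sub (differentiable_comp_real_smul hy s)

variable [DecidableEq ι]

/-- A pair of forms with an entire weight function. -/
abbrev WeightedPair (W X : Type*) [NormedAddCommGroup W] [NormedSpace ℂ W]
    [NormedAddCommGroup X] [NormedSpace ℂ X] : Type _ :=
  FormPair X × {b : W → ℂ // Differentiable ℂ b}

/-- A move along the kernel of a form `l` in the direction of a projection of `radialDiff`. -/
noncomputable def projMove (l l' : X →L[ℂ] ℂ) (π : X →L[ℂ] X) (hl : ∀ v, l (π v) = 0)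
    {y : W → ι → X} (hy : Differentiable ℂ y) {b : W → ℂ} (hb : Differentiable ℂ b) (s s' : ℝ) :
    Move ι W X where
  lam := l
  dir w i := (b (s • w) * sepDet l' (y (s • w))) • π (radialDiff y s s' w i)
  differentiable_dir := differentiable_pi.2 fun i => by
    have h1 : Differentiable ℂ fun w => sepDet l' (y (s • w)) :=
      Differentiable.comp (g := sepDet l') (differentiable_sepDet l')
        (differentiable_comp_real_smul hy s)
    have h2 : Differentiable ℂ fun w => π (radialDiff y s s' w i) :=
      π.differentiable.comp (differentiable_pi.1 (differentiable_radialDiff hy s s') i)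
    exact ((differentiable_comp_real_smul hb s).mul h1).smul h2
  lam_dir w i := by simp [hl]

theorem norm_projMove_dir_le (l l' : X →L[ℂ] ℂ) (π : X →L[ℂ] X) (hl : ∀ v, l (π v) = 0)
    {y : W → ι → X} (hy : Differentiable ℂ y) {b : W → ℂ} (hb : Differentiable ℂ b) (s s' : ℝ)
    (w : W) : ‖(projMove l l' π hl hy hb s s').dir w‖ ≤
      ‖b (s • w)‖ * (‖sepDet l' (y (s • w))‖ * ‖π‖) * ‖radialDiff y s s' w‖ := by
  refine (pi_norm_le_iff_of_nonneg (by positivity)).2 fun i => ?_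
  simp only [projMove, norm_smul, norm_mul]
  calc _ ≤ ‖b (s • w)‖ * ‖sepDet l' (y (s • w))‖ * (‖π‖ * ‖radialDiff y s s' w‖) := by
        gcongr
        exact (π.le_opNorm _).trans (by gcongr; exact norm_le_pi_norm _ i)
    _ = _ := by ring

/-- The moves of one step of the Euler scheme. -/
noncomputable def stepMoves {y : W → ι → X} (hy : Differentiable ℂ y)
    (L : List (WeightedPair W X)) (s s' : ℝ) : List (Move ι W X) :=
  L.flatMap fun e =>
    [projMove e.1.lam e.1.mu e.1.projLam e.1.lam_projLam hy e.2.2 s s',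
      projMove e.1.mu e.1.lam e.1.projVec e.1.mu_projVec hy e.2.2 s s']

/-- The size, weighted by `Γ`, of the moves attached to a pair of forms. -/
noncomputable def FormPair.weight (c : FormPair X) (Γ : (X →L[ℂ] ℂ) → ℝ) (a : ι → X) : ℝ :=
  Γ c.lam * (‖sepDet c.mu a‖ * ‖c.projLam‖) + Γ c.mu * (‖sepDet c.lam a‖ * ‖c.projVec‖)

theorem FormPair.continuous_weight (c : FormPair X) (Γ : (X →L[ℂ] ℂ) → ℝ) :
    Continuous (c.weight Γ : (ι → X) → ℝ) := by
  have h1 : Continuous fun a : ι → X => sepDet c.mu a := (differentiable_sepDet c.mu).continuous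
  have h2 : Continuous fun a : ι → X => sepDet c.lam a := (differentiable_sepDet c.lam).continuous
  unfold FormPair.weight
  fun_prop

theorem FormPair.weight_nonneg (c : FormPair X) {Γ : (X →L[ℂ] ℂ) → ℝ} (hΓ : ∀ l, 0 ≤ Γ l)
    (a : ι → X) : 0 ≤ c.weight Γ a := by
  have h1 := hΓ c.lam
  have h2 := hΓ c.mu
  unfold FormPair.weight
  positivity

theorem mem_stepMoves_lam {y : W → ι → X} (hy : Differentiable ℂ y)
    {L : List (WeightedPair W X)} {s s' : ℝ} {t : Move ι W X} (ht : t ∈ stepMoves hy L s s') :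
    ∃ e ∈ L, t.lam = e.1.lam ∨ t.lam = e.1.mu := by
  obtain ⟨e, he, hte⟩ := List.mem_flatMap.1 ht
  refine ⟨e, he, ?_⟩
  rcases List.mem_pair.1 hte with rfl | rfl
  · exact Or.inl rfl
  · exact Or.inr rfl

theorem sum_stepMoves {y : W → ι → X} (hy : Differentiable ℂ y)
    (L : List (WeightedPair W X)) (s s' : ℝ) (w : W) :
    ((stepMoves hy L s s').map fun t => sepDet t.lam (y (s • w)) • t.dir w).sum =
      (L.map fun e => e.2.1 (s • w) * e.1.det (y (s • w))).sum • radialDiff y s s' w := by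
  induction L with
  | nil => simp [stepMoves]
  | cons e L ih =>
    rw [stepMoves] at ih ⊢
    rw [List.flatMap_cons, List.map_append, List.sum_append, ih]
    simp only [List.map_cons, List.map_nil, List.sum_cons, List.sum_nil, add_zero, add_smul]
    congr 1
    funext i
    have h := e.1.projLam_add_projVec (radialDiff y s s' w i)
    simp only [Pi.add_apply, Pi.smul_apply, projMove, smul_smul, FormPair.det]
    conv_rhs => rw [← h, smul_add]
    congr 2 <;> ring

theorem sum_norm_stepMoves_le {y : W → ι → X} (hy : Differentiable ℂ y)
    (L : List (WeightedPair W X)) (s s' : ℝ) (w : W) {Γ : (X →L[ℂ] ℂ) → ℝ} (hΓ : ∀ l, 0 ≤ Γ l) :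
    ((stepMoves hy L s s').map fun t => Γ t.lam * ‖t.dir w‖).sum ≤
      (L.map fun e => ‖e.2.1 (s • w)‖ * e.1.weight Γ (y (s • w))).sum *
        ‖radialDiff y s s' w‖ := by
  induction L with
  | nil => simp [stepMoves]
  | cons e L ih =>
    rw [stepMoves] at ih ⊢
    rw [List.flatMap_cons, List.map_append, List.sum_append]
    simp only [List.map_cons, List.map_nil, List.sum_cons, List.sum_nil, add_zero, add_mul]
    refine add_le_add ?_ ih
    have h1 := mul_le_mul_of_nonneg_left (norm_projMove_dir_le e.1.lam e.1.mu e.1.projLam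
      e.1.lam_projLam hy e.2.2 s s' w) (hΓ e.1.lam)
    have h2 := mul_le_mul_of_nonneg_left (norm_projMove_dir_le e.1.mu e.1.lam e.1.projVec
      e.1.mu_projVec hy e.2.2 s s' w) (hΓ e.1.mu)
    refine (add_le_add h1 h2).trans (le_of_eq ?_)
    rw [FormPair.weight]
    ring

/-- The moves of the first `k` steps, out of `p`, of the Euler scheme. -/
noncomputable def eulerMoves {y : W → ι → X} (hy : Differentiable ℂ y)
    (L : List (WeightedPair W X)) (p k : ℕ) : List (Move ι W X) :=
  (List.range k).flatMap fun j : ℕ => stepMoves hy L (1 - j / p) (1 - (j + 1 : ℕ) / p)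

theorem eulerMoves_succ {y : W → ι → X} (hy : Differentiable ℂ y)
    (L : List (WeightedPair W X)) (p k : ℕ) :
    eulerMoves hy L p (k + 1) =
      eulerMoves hy L p k ++ stepMoves hy L (1 - k / p) (1 - (k + 1 : ℕ) / p) := by
  simp [eulerMoves, List.range_succ]

theorem sum_norm_eulerMoves_le {y : W → ι → X} (hy : Differentiable ℂ y)
    {L : List (WeightedPair W X)} {w : W} {Γ : (X →L[ℂ] ℂ) → ℝ} (hΓ : ∀ l, 0 ≤ Γ l) {K Λ : ℝ}
    (hK0 : 0 ≤ K)
    (hK : ∀ s ∈ Icc (0 : ℝ) 1,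
      (L.map fun e => ‖e.2.1 (s • w)‖ * e.1.weight Γ (y (s • w))).sum ≤ K)
    (hΛ : ∀ s ∈ Icc (0 : ℝ) 1, ∀ s' ∈ Icc (0 : ℝ) 1, ‖y (s' • w) - y (s • w)‖ ≤ Λ * |s' - s|)
    {p : ℕ} (hp : 0 < p) :
    ((eulerMoves hy L p p).map fun t => Γ t.lam * ‖t.dir w‖).sum ≤ K * Λ := by
  have h : ∀ k ≤ p, ((eulerMoves hy L p k).map fun t => Γ t.lam * ‖t.dir w‖).sum ≤
      k * (K * (Λ / p)) := by
    intro k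
    induction k with
    | zero => simp [eulerMoves]
    | succ k ih =>
      intro hk
      rw [eulerMoves_succ, List.map_append, List.sum_append]
      have h1 := sum_norm_stepMoves_le hy L (1 - k / p) (1 - (k + 1 : ℕ) / p) w hΓ
      have h2 := mul_le_mul (hK _ (one_sub_div_mem_Icc (k := k) (p := p) (by omega)))
        (norm_radialDiff_le hk hΛ) (norm_nonneg _) hK0
      have h3 := ih (by omega)
      push_cast at *
      linarith
  refine (h p le_rfl).trans (le_of_eq ?_)
  have : (p : ℝ) ≠ 0 := by positivity
  field_simp

/-- Convergence of the Euler scheme. -/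
theorem norm_eulerMoves_sub_le {y : W → ι → X} (hy : Differentiable ℂ y)
    {L : List (WeightedPair W X)} {w : W} {A C K M Λ η : ℝ}
    (hA0 : 0 ≤ A) (hC0 : 0 ≤ C) (hK0 : 0 ≤ K) (hΛ0 : 0 ≤ Λ) (hη0 : 0 ≤ η)
    (hA : ∀ e ∈ L, ∀ a : ι → X, ‖a‖ ≤ M → ‖sepDet e.1.lam a‖ ≤ A ∧ ‖sepDet e.1.mu a‖ ≤ A)
    (hC : ∀ e ∈ L, ∀ a b : ι → X, ‖a‖ ≤ M → ‖b‖ ≤ M →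
      ‖sepDet e.1.lam a - sepDet e.1.lam b‖ ≤ C * ‖a - b‖ ∧
      ‖sepDet e.1.mu a - sepDet e.1.mu b‖ ≤ C * ‖a - b‖)
    (hM : ∀ s ∈ Icc (0 : ℝ) 1, ‖y (s • w)‖ + 1 ≤ M)
    (hη : ∀ s ∈ Icc (0 : ℝ) 1,
      ‖(L.map fun e => e.2.1 (s • w) * e.1.det (y (s • w))).sum - 1‖ ≤ η)
    (hK : ∀ s ∈ Icc (0 : ℝ) 1,
      (L.map fun e => ‖e.2.1 (s • w)‖ * e.1.weight (fun _ => 1) (y (s • w))).sum ≤ K)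
    (hΛ : ∀ s ∈ Icc (0 : ℝ) 1, ∀ s' ∈ Icc (0 : ℝ) 1, ‖y (s' • w) - y (s • w)‖ ≤ Λ * |s' - s|)
    {p : ℕ} (hp : 0 < p) (hpA : A * (K * Λ / p) ≤ 1 / 2)
    (hpQ : (C * A * (K * Λ) ^ 2 / p + η * Λ) * Real.exp (C * K * Λ) ≤ 1 / 2) :
    ‖moveConfig (eulerMoves hy L p p) w (y w) - y 0‖ ≤
      (C * A * (K * Λ) ^ 2 / p + η * Λ) * Real.exp (C * K * Λ) := by
  have hp0 : (0 : ℝ) < p := by exact_mod_cast hp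
  set Q := C * A * (K * Λ) ^ 2 / p + η * Λ with hQ
  have hQ0 : 0 ≤ Q := by positivity
  have hexp : ∀ k ≤ p, (k / p * Q * (1 + C * K * Λ / p) ^ k : ℝ) ≤
      Q * Real.exp (C * K * Λ) := fun k hk => by
    have hk' : (k : ℝ) ≤ p := by exact_mod_cast hk
    have h1 : (k / p : ℝ) ≤ 1 := div_le_one_of_le₀ hk' hp0.le
    have h2 : (1 + C * K * Λ / p) ^ k ≤ Real.exp (C * K * Λ) := by
      calc (1 + C * K * Λ / p) ^ k ≤ Real.exp (C * K * Λ / p) ^ k := by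
            gcongr
            linarith [Real.add_one_le_exp (C * K * Λ / p)]
        _ = Real.exp (k * (C * K * Λ / p)) := by rw [Real.exp_nat_mul]
        _ ≤ _ := by
          rw [Real.exp_le_exp]
          calc k * (C * K * Λ / p) = k / p * (C * K * Λ) := by ring
            _ ≤ 1 * (C * K * Λ) := by gcongr
            _ = _ := one_mul _
    calc _ ≤ 1 * Q * Real.exp (C * K * Λ) := by gcongr
      _ = _ := by ring
  have main : ∀ k ≤ p, ‖moveConfig (eulerMoves hy L p k) w (y w) - y ((1 - k / p : ℝ) • w)‖ ≤
      k / p * Q * (1 + C * K * Λ / p) ^ k := by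
    intro k
    induction k with
    | zero => simp [eulerMoves, moveConfig]
    | succ k ih =>
      intro hk
      have hs := one_sub_div_mem_Icc (k := k) (p := p) (by omega)
      have he := ih (by omega)
      have heh := (he.trans (hexp k (by omega))).trans hpQ
      rw [eulerMoves_succ, moveConfig_append]
      set z := moveConfig (eulerMoves hy L p k) w (y w)
      set s : ℝ := 1 - k / p with hsdef
      set s' : ℝ := 1 - (k + 1 : ℕ) / p with hsdef'
      have hv := norm_radialDiff_le hk hΛ
      have hσ := sum_norm_stepMoves_le hy L s s' w (Γ := fun _ => 1) (fun _ => zero_le_one)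
      simp only [one_mul] at hσ
      replace hσ : ((stepMoves hy L s s').map fun t => ‖t.dir w‖).sum ≤ K * Λ / p := by
        refine hσ.trans ((mul_le_mul (hK s hs) hv (norm_nonneg _) hK0).trans (le_of_eq ?_))
        ring
      have hσ0 : 0 ≤ ((stepMoves hy L s s').map fun t => ‖t.dir w‖).sum := by
        refine List.sum_nonneg fun a ha => ?_
        obtain ⟨t, _, rfl⟩ := List.mem_map.1 ha
        exact norm_nonneg _
      have hstep := norm_moveConfig_sub_le (stepMoves hy L s s') (w := w) (y := y (s • w)) (z := z)
        (A := A) (C := C) (M := M) hA0 hC0 ?_ ?_ (hM s hs) ?_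
      · rw [sum_stepMoves] at hstep
        set σ := ((stepMoves hy L s s').map fun t => ‖t.dir w‖).sum
        set g := (L.map fun e => e.2.1 (s • w) * e.1.det (y (s • w))).sum
        have hg : ‖(g - 1) • radialDiff y s s' w‖ ≤ η * (Λ / p) := by
          rw [norm_smul]
          exact mul_le_mul (hη s hs) hv (norm_nonneg _) hη0
        have hsplit : moveConfig (stepMoves hy L s s') w z - y (s' • w) =
            (moveConfig (stepMoves hy L s s') w z - z - g • radialDiff y s s' w)
              + (g - 1) • radialDiff y s s' w + (z - y (s • w)) := by
          have hrad : y (s' • w) = y (s • w) + radialDiff y s s' w := by simp [radialDiff]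
          rw [hrad, sub_smul g, one_smul]
          abel
        rw [hsplit]
        have hq : 0 ≤ C * K * Λ / p := by positivity
        calc _ ≤ C * (‖z - y (s • w)‖ + A * σ) * σ + η * (Λ / p) + ‖z - y (s • w)‖ :=
              norm_add₃_le.trans (by gcongr)
          _ ≤ C * (‖z - y (s • w)‖ + A * (K * Λ / p)) * (K * Λ / p) + η * (Λ / p)
              + ‖z - y (s • w)‖ := by gcongr
          _ = (1 + C * K * Λ / p) * ‖z - y (s • w)‖ + Q / p := by
              rw [hQ]
              ring
          _ ≤ (1 + C * K * Λ / p) * (k / p * Q * (1 + C * K * Λ / p) ^ k) + Q / p := by gcongr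
          _ ≤ (1 + C * K * Λ / p) * (k / p * Q * (1 + C * K * Λ / p) ^ k)
              + Q / p * (1 + C * K * Λ / p) ^ (k + 1) := by
              gcongr
              exact le_mul_of_one_le_right (by positivity) (one_le_pow₀ (by linarith))
          _ = _ := by
              push_cast
              ring
      · intro t ht a ha
        obtain ⟨e, he, h | h⟩ := mem_stepMoves_lam hy ht <;> rw [h]
        · exact (hA e he a ha).1
        · exact (hA e he a ha).2
      · intro t ht a b ha hb
        obtain ⟨e, he, h | h⟩ := mem_stepMoves_lam hy ht <;> rw [h]
        · exact (hC e he a b ha hb).1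
        · exact (hC e he a b ha hb).2
      · have : A * ((stepMoves hy L s s').map fun t => ‖t.dir w‖).sum ≤ A * (K * Λ / p) := by
          gcongr
        linarith
  have := (main p le_rfl).trans (hexp p le_rfl)
  rwa [div_self hp0.ne', sub_self, zero_smul] at this

end Euler

section EulerConvergence

variable {ι W X : Type*} [Fintype ι] [DecidableEq ι] [NormedAddCommGroup W] [NormedSpace ℂ W]
  [ProperSpace W] [NormedAddCommGroup X] [NormedSpace ℂ X] [ProperSpace X]

theorem FormPair.exists_weight_le (c : FormPair X) (Γ : (X →L[ℂ] ℂ) → ℝ) (M : ℝ) :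
    ∃ A : ℝ, 0 ≤ A ∧ ∀ a : ι → X, ‖a‖ ≤ M → c.weight Γ a ≤ A := by
  obtain ⟨A, hA⟩ := (isCompact_closedBall (0 : ι → X) M).exists_bound_of_continuousOn
    (c.continuous_weight Γ).continuousOn
  exact ⟨max A 0, le_max_right _ _, fun a ha => (Real.le_norm_self _).trans
    ((hA a (by simpa using ha)).trans (le_max_left _ _))⟩

theorem exists_norm_sepDet_le (l : X →L[ℂ] ℂ) (M : ℝ) :
    ∃ A : ℝ, 0 ≤ A ∧ (∀ a : ι → X, ‖a‖ ≤ M → ‖sepDet l a‖ ≤ A) ∧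
      ∀ a b : ι → X, ‖a‖ ≤ M → ‖b‖ ≤ M → ‖sepDet l a - sepDet l b‖ ≤ A * ‖a - b‖ := by
  obtain ⟨A, hA⟩ := (isCompact_closedBall (0 : ι → X) M).exists_bound_of_continuousOn
    (differentiable_sepDet l).continuous.continuousOn
  obtain ⟨C, hC0, hC⟩ := exists_lipschitz_closedBall (differentiable_sepDet (ι := ι) l) M
  refine ⟨max A C, hC0.trans (le_max_right _ _), fun a ha => (hA a (by simpa using ha)).trans
    (le_max_left _ _), fun a b ha hb => (hC a b ha hb).trans ?_⟩
  gcongr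
  exact le_max_right _ _

/-- The Euler scheme contracts a moving configuration to its value at the origin. -/
theorem exists_eulerMoves_near {y : W → ι → X} (hy : Differentiable ℂ y) {R : ℝ} (hR : 0 ≤ R)
    (P : Finset (FormPair X)) (ν : ℕ) {N : ℝ} (hN : 0 ≤ N) {ε : ℝ} (hε : 0 < ε) :
    ∃ η > 0, ∀ L : List (WeightedPair W X), L.length ≤ ν → (∀ e ∈ L, e.1 ∈ P) →
      (∀ e ∈ L, ∀ w ∈ closedBall (0 : W) R, ‖e.2.1 w‖ ≤ N) →
      (∀ w ∈ closedBall (0 : W) R, ‖(L.map fun e => e.2.1 w * e.1.det (y w)).sum - 1‖ ≤ η) →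
      ∃ p > 0, ∀ w ∈ closedBall (0 : W) R,
        ‖moveConfig (eulerMoves hy L p p) w (y w) - y 0‖ ≤ ε := by
  obtain ⟨M, hM⟩ := (isCompact_closedBall (0 : W) R).exists_bound_of_continuousOn
    hy.continuous.continuousOn
  obtain ⟨Λ', hΛ0', hΛ'⟩ := exists_lipschitz_closedBall hy R
  choose a ha0 ha haL using fun l => exists_norm_sepDet_le (ι := ι) (X := X) l (M + 1)
  choose b hb0 hb using fun c : FormPair X => c.exists_weight_le (ι := ι) (fun _ => 1) (M + 1)
  set A := ∑ c ∈ P, (a c.lam + a c.mu + b c) with hA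
  have hA0 : 0 ≤ A := Finset.sum_nonneg fun c _ => by
    linarith [ha0 c.lam, ha0 c.mu, hb0 c]
  have hAc : ∀ c ∈ P, a c.lam ≤ A ∧ a c.mu ≤ A ∧ b c ≤ A := fun c hc => by
    have := Finset.single_le_sum (f := fun c : FormPair X => a c.lam + a c.mu + b c)
      (fun c _ => by linarith [ha0 c.lam, ha0 c.mu, hb0 c]) hc
    have h1 := ha0 c.lam
    have h2 := ha0 c.mu
    have h3 := hb0 c
    refine ⟨?_, ?_, ?_⟩ <;> linarith
  set Λ := Λ' * R with hΛdef
  have hΛ0 : 0 ≤ Λ := by positivity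
  set K := ν * (N * A) with hK
  have hK0 : 0 ≤ K := by positivity
  set E := Real.exp (A * K * Λ) with hE
  have hE0 : 0 < E := Real.exp_pos _
  set ε' := min ε (1 / 2) with hε'
  have hε0 : 0 < ε' := by positivity
  refine ⟨ε' / (2 * E * (Λ + 1)), by positivity, fun L hlen hP hLN hL => ?_⟩
  obtain ⟨p, hp⟩ := exists_nat_gt (2 * A * K * Λ + 2 * A * A * (K * Λ) ^ 2 * E / ε')
  have hp0 : (0 : ℝ) < p := lt_of_le_of_lt (by positivity) hp
  have hpn : 0 < p := by exact_mod_cast hp0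
  refine ⟨p, hpn, fun w hw => ?_⟩
  have hsw : ∀ s ∈ Icc (0 : ℝ) 1, ‖s • w‖ ≤ R := fun s hs => by
    rw [norm_smul, Real.norm_of_nonneg hs.1]
    rw [mem_closedBall_zero_iff] at hw
    nlinarith [hs.1, hs.2, norm_nonneg w]
  have hsw' : ∀ s ∈ Icc (0 : ℝ) 1, s • w ∈ closedBall (0 : W) R := fun s hs => by
    simpa using hsw s hs
  have hbd : (A * A * (K * Λ) ^ 2 / p + ε' / (2 * E * (Λ + 1)) * Λ) * E ≤ ε' := by
    have h1 : 2 * A * A * (K * Λ) ^ 2 * E / ε' ≤ p := by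
      have : 0 ≤ 2 * A * K * Λ := by positivity
      linarith
    have h2 : A * A * (K * Λ) ^ 2 / p * E ≤ ε' / 2 := by
      rw [div_le_iff₀ hε0] at h1
      rw [div_mul_eq_mul_div, div_le_iff₀ hp0]
      linarith
    have h3 : ε' / (2 * E * (Λ + 1)) * Λ * E = ε' / 2 * (Λ / (Λ + 1)) := by
      field_simp
    have h4 : Λ / (Λ + 1) ≤ 1 := div_le_one_of_le₀ (by linarith) (by linarith)
    have h5 : ε' / 2 * (Λ / (Λ + 1)) ≤ ε' / 2 * 1 := by gcongr
    rw [add_mul, h3]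
    linarith
  refine (norm_eulerMoves_sub_le hy (A := A) (C := A) (K := K) (M := M + 1) (Λ := Λ) hA0 hA0 hK0
    hΛ0 (by positivity) ?_ ?_ ?_ (fun s hs => hL _ (hsw' s hs)) ?_ ?_ hpn ?_
    (hbd.trans (min_le_right _ _))).trans (hbd.trans (min_le_left _ _))
  · intro e he u hu
    exact ⟨(ha _ u hu).trans (hAc _ (hP e he)).1, (ha _ u hu).trans (hAc _ (hP e he)).2.1⟩
  · intro e he u v hu hv
    refine ⟨(haL _ u v hu hv).trans ?_, (haL _ u v hu hv).trans ?_⟩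
    · gcongr
      exact (hAc _ (hP e he)).1
    · gcongr
      exact (hAc _ (hP e he)).2.1
  · intro s hs
    linarith [hM _ (hsw' s hs)]
  · intro s hs
    have hterm : ∀ t ∈ L.map fun e => ‖e.2.1 (s • w)‖ * e.1.weight (fun _ => 1) (y (s • w)),
        t ≤ N * A := by
      intro t ht
      obtain ⟨e, he, rfl⟩ := List.mem_map.1 ht
      have hwt := (hb e.1 (y (s • w)) (by linarith [hM _ (hsw' s hs)])).trans (hAc _ (hP e he)).2.2
      exact mul_le_mul (hLN e he _ (hsw' s hs)) hwt
        (e.1.weight_nonneg (fun _ => zero_le_one) _) hN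
    refine (List.sum_le_card_nsmul _ _ hterm).trans ?_
    rw [List.length_map, nsmul_eq_mul, hK]
    have : (L.length : ℝ) ≤ ν := by exact_mod_cast hlen
    gcongr
  · intro s hs s' hs'
    refine (hΛ' _ _ (hsw s' hs') (hsw s hs)).trans ?_
    rw [← sub_smul, norm_smul, Real.norm_eq_abs, hΛdef]
    rw [mem_closedBall_zero_iff] at hw
    calc Λ' * (|s' - s| * ‖w‖) ≤ Λ' * (|s' - s| * R) := by gcongr
      _ = _ := by ring
  · have : 0 ≤ 2 * A * A * (K * Λ) ^ 2 * E / ε' := by positivity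
    rw [mul_div_assoc', div_le_iff₀ hp0]
    nlinarith

end EulerConvergence

section ApproxInverse

variable {m : ℕ}

/-- A zero-free function on a ball has approximate inverses that are entire. -/
theorem exists_entire_approx_inv {R : ℝ} (hR : 0 ≤ R) {h : EuclideanSpace ℂ (Fin m) → ℂ}
    (hh : Differentiable ℂ h) (hz : ∀ w ∈ closedBall 0 R, h w ≠ 0) {ε : ℝ} (hε : 0 < ε) :
    ∃ g : EuclideanSpace ℂ (Fin m) → ℂ, Differentiable ℂ g ∧
      ∀ w ∈ closedBall 0 R, ‖g w * h w - 1‖ ≤ ε := by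
  obtain ⟨S, B, hSB⟩ := exists_entire_bezout (ι := Unit) hR (h := fun _ => h) (fun _ => hh)
    (fun w hw => ⟨(), hz w hw⟩)
  obtain ⟨α, hα, -, hα'⟩ := hSB ε hε
  refine ⟨fun w => ∑ i ∈ S, α i w, Differentiable.fun_sum fun i _ => hα i, fun w hw => ?_⟩
  rw [Finset.sum_mul]
  exact hα' w hw

end ApproxInverse

section Contraction

/-- Cauchy's estimate for a map that is nearly constant on a ball. -/
theorem norm_sub_le_of_near_const {E F : Type*} [NormedAddCommGroup E] [NormedSpace ℂ E]
    [NormedAddCommGroup F] [NormedSpace ℂ F] {y : E → F} (hy : Differentiable ℂ y) {b : F}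
    {r r' δ : ℝ} (hr : r < r') (hδ : 0 ≤ δ) (h : ∀ w ∈ closedBall (0 : E) r', ‖y w - b‖ ≤ δ)
    {u v : E} (hu : ‖u‖ ≤ r) (hv : ‖v‖ ≤ r) : ‖y u - y v‖ ≤ δ / (r' - r) * ‖u - v‖ := by
  have := (convex_closedBall (0 : E) r).norm_image_sub_le_of_norm_fderiv_le (𝕜 := ℂ)
    (f := fun w => y w - b) (C := δ / (r' - r)) (x := v) (y := u)
    (fun w _ => (hy w).sub_const b) (fun w hw => ?_) (by simpa using hv) (by simpa using hu)
  · simpa using this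
  · refine norm_fderiv_le_of_closedBall (sub_pos.2 hr) hδ (fun z _ => (hy z).sub_const b)
      fun z hz => h z ?_
    rw [mem_closedBall_zero_iff] at hw ⊢
    rw [mem_closedBall_iff_norm'] at hz
    linarith [norm_le_norm_add_norm_sub w z]

variable {ι X : Type*} [Fintype ι] [DecidableEq ι] {m : ℕ} [NormedAddCommGroup X]
  [NormedSpace ℂ X] [FiniteDimensional ℂ X] [ProperSpace X]

/-- A moving configuration of distinct points that is nearly constant on a ball can be made nearly
constant on a larger ball by automorphisms that are close to the identity over a smaller ball. -/
theorem exists_autFamily_contraction (hX : 2 ≤ Module.finrank ℂ X) {xh : ι → X}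
    (hxh : Function.Injective xh) {r r' R : ℝ} (hr : 0 ≤ r) (hr' : r < r') (hR : r' ≤ R) {ε : ℝ}
    (hε : 0 < ε) (ρ : ℝ) :
    ∃ δ > 0, ∀ y : EuclideanSpace ℂ (Fin m) → ι → X, Differentiable ℂ y →
      (∀ w, Function.Injective (y w)) → (∀ w ∈ closedBall 0 r', ‖y w - xh‖ ≤ δ) →
      ∃ κ : AutFamily (EuclideanSpace ℂ (Fin m)) X,
        (∀ w ∈ closedBall 0 R, ∀ i, ‖κ.toFun w (y w i) - xh i‖ ≤ ε) ∧
        ∀ w ∈ closedBall 0 r, κ.NearId w ρ ε := by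
  classical
  obtain ⟨c₀, hc₀, -⟩ := FormPair.exists_det_ne_zero hX hxh hxh
  set ρ' := max ρ (‖xh‖ + 2) with hρ'
  choose Γ hΓ0 hΓ using fun l => exists_norm_shearVec_le (ι := ι) (X := X) l ρ'
  choose k hk0 hk using fun c : FormPair X => c.exists_weight_le (ι := ι) Γ (‖xh‖ + 1)
  set q := ‖c₀.det xh‖ with hq
  have hq0 : 0 < q := norm_pos_iff.2 hc₀
  obtain ⟨δ', hδ'0, hδ'⟩ := Metric.continuousAt_iff.1
    (c₀.differentiable_det.continuous.continuousAt (x := xh)) (q / 2) (by positivity)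
  set D := 4 / q * k c₀ + 1 with hD
  have hD0 : 0 < D := by
    have := hk0 c₀
    positivity
  have hrr : 0 < r' - r := sub_pos.2 hr'
  refine ⟨min (min 1 (ε / 2)) (min (δ' / 2) (min ε 1 * (r' - r) / (D * (r + 1)))), by positivity,
    fun y hy hinj hnear => ?_⟩
  set δ := min (min 1 (ε / 2)) (min (δ' / 2) (min ε 1 * (r' - r) / (D * (r + 1)))) with hδ
  have hδ0 : 0 < δ := by positivity
  have hδ1 : δ ≤ 1 := (min_le_left _ _).trans (min_le_left _ _)
  have hδ2 : δ ≤ ε / 2 := (min_le_left _ _).trans (min_le_right _ _)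
  have hδ3 : δ ≤ δ' / 2 := (min_le_right _ _).trans (min_le_left _ _)
  have hδ4 : D * (δ / (r' - r) * r) ≤ min ε 1 := by
    have h1 : δ ≤ min ε 1 * (r' - r) / (D * (r + 1)) := (min_le_right _ _).trans (min_le_right _ _)
    rw [le_div_iff₀ (by positivity)] at h1
    rw [show D * (δ / (r' - r) * r) = D * δ * r / (r' - r) by ring, div_le_iff₀ hrr]
    have : 0 ≤ δ * D := by positivity
    linarith
  have hr'0 : 0 ≤ r' := hr.trans hr'.le
  have hR0 : 0 ≤ R := hr'0.trans hR
  have hdet : ∀ w ∈ closedBall (0 : EuclideanSpace ℂ (Fin m)) r', q / 2 ≤ ‖c₀.det (y w)‖ := by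
    intro w hw
    have h1 := hδ' (x := y w) (by rw [dist_eq_norm]; linarith [hnear w hw])
    rw [dist_eq_norm] at h1
    have h2 := norm_le_norm_add_norm_sub (c₀.det (y w)) (c₀.det xh)
    linarith
  have hdd : ∀ c : FormPair X, Differentiable ℂ fun w => c.det (y w) := fun c =>
    Differentiable.comp (g := c.det) c.differentiable_det hy
  obtain ⟨S, B, hSB⟩ := exists_entire_bezout hR0 (h := fun (c : FormPair X) w => c.det (y w)) hdd
    fun w _ => (FormPair.exists_det_ne_zero hX (hinj w) (hinj w)).imp fun c hc => hc.1
  have hs₀0 : 0 ≤ ∑ c ∈ S, |B| * k c := Finset.sum_nonneg fun c _ => mul_nonneg (abs_nonneg _) (hk0 c)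
  set s₀ := ∑ c ∈ S, |B| * k c with hs₀
  obtain ⟨F, hF, hF'⟩ := exists_entire_approx_inv hr'0 (hdd c₀)
    (fun w hw => norm_pos_iff.1 (lt_of_lt_of_le (by positivity) (hdet w hw)))
    (ε := min 1 (1 / (s₀ + 1))) (by positivity)
  set T : EuclideanSpace ℂ (Fin m) → ℂ := fun w => 1 - F w * c₀.det (y w) with hT
  have hTd : Differentiable ℂ T := (differentiable_const _).sub (hF.mul (hdd c₀))
  obtain ⟨M₁, hM₁⟩ := (isCompact_closedBall (0 : EuclideanSpace ℂ (Fin m))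
    R).exists_bound_of_continuousOn hF.continuous.continuousOn
  obtain ⟨M₂, hM₂⟩ := (isCompact_closedBall (0 : EuclideanSpace ℂ (Fin m))
    R).exists_bound_of_continuousOn hTd.continuous.continuousOn
  have hM₁0 : 0 ≤ M₁ := (norm_nonneg _).trans (hM₁ 0 (by simpa using hR0))
  have hM₂0 : 0 ≤ M₂ := (norm_nonneg _).trans (hM₂ 0 (by simpa using hR0))
  obtain ⟨η, hη, hEuler⟩ := exists_eulerMoves_near hy hR0 (insert c₀ S) (S.card + 1)
    (N := M₁ + |B| * M₂) (by positivity) (ε := ε / 2) (by positivity)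
  obtain ⟨α, hα, hαB, hα'⟩ := hSB (η / (M₂ + 1)) (by positivity)
  set L : List (WeightedPair (EuclideanSpace ℂ (Fin m)) X) := (c₀, ⟨F, hF⟩) ::
    S.toList.map fun c => (c, ⟨fun w => α c w * T w, (hα c).mul hTd⟩) with hL
  have hp := hEuler L (by simp [hL]) ?_ ?_ ?_
  · obtain ⟨p, hp, hconv⟩ := hp
    obtain ⟨κ, hκ, hκn⟩ := exists_autFamily_moveConfig (eulerMoves hy L p p) hy
    refine ⟨κ, fun w hw i => ?_, fun w hw => ?_⟩
    · rw [hκ]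
      have h1 := (norm_le_pi_norm _ i).trans (hconv w hw)
      have h2 := (norm_le_pi_norm _ i).trans (hnear 0 (by simpa using hr'0))
      simp only [Pi.sub_apply] at h1 h2
      calc _ = ‖(moveConfig (eulerMoves hy L p p) w (y w) i - y 0 i) + (y 0 i - xh i)‖ := by simp
        _ ≤ ε / 2 + δ := (norm_add_le _ _).trans (add_le_add h1 h2)
        _ ≤ ε := by linarith
    · rw [mem_closedBall_zero_iff] at hw
      have hsw : ∀ s ∈ Icc (0 : ℝ) 1, ‖s • w‖ ≤ r := fun s hs => by
        rw [norm_smul, Real.norm_of_nonneg hs.1]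
        nlinarith [hs.1, hs.2, norm_nonneg w]
      have hyle : ∀ v : EuclideanSpace ℂ (Fin m), ‖v‖ ≤ r → ‖y v‖ ≤ ‖xh‖ + 1 := fun v hv => by
        have h1 := hnear v (by rw [mem_closedBall_zero_iff]; linarith)
        have h2 := norm_le_norm_add_norm_sub xh (y v)
        rw [norm_sub_rev] at h2
        linarith
      have hsum := sum_norm_eulerMoves_le hy (L := L) (w := w) hΓ0 (K := D)
        (Λ := δ / (r' - r) * r) hD0.le ?_ ?_ hp
      · have hsum' := hsum.trans hδ4
        have hyw := hyle w hw
        have := hκn w ρ' Γ hΓ0 hΓ (by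
          have : ‖xh‖ + 2 ≤ ρ' := le_max_right _ _
          linarith [min_le_right ε 1])
        intro z hz
        exact (this.mono (hsum'.trans (min_le_left _ _))) z (hz.trans (le_max_left _ _))
      · intro s hs
        have hs' := hsw s hs
        have hsr' : s • w ∈ closedBall (0 : EuclideanSpace ℂ (Fin m)) r' := by
          rw [mem_closedBall_zero_iff]
          linarith
        have hsR := closedBall_subset_closedBall hR hsr'
        set v := s • w
        have hTv : ‖T v‖ ≤ min 1 (1 / (s₀ + 1)) := by
          rw [hT, norm_sub_rev]
          exact hF' v hsr'
        have hFv : ‖F v‖ ≤ 4 / q := by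
          have h1 : ‖F v‖ * ‖c₀.det (y v)‖ ≤ 2 := by
            rw [← norm_mul, show F v * c₀.det (y v) = 1 - T v by simp [hT]]
            have := norm_sub_le (1 : ℂ) (T v)
            rw [norm_one] at this
            linarith [hTv.trans (min_le_left _ _)]
          have h2 := mul_le_mul_of_nonneg_left (hdet v hsr') (norm_nonneg (F v))
          rw [le_div_iff₀ hq0]
          linarith
        rw [hL, List.map_cons, List.sum_cons, List.map_map]
        refine add_le_add ?_ ?_
        · exact mul_le_mul hFv (hk c₀ _ (hyle v hs')) (c₀.weight_nonneg hΓ0 _) (by positivity)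
        · refine le_of_eq_of_le (Finset.sum_map_toList S _) ?_
          calc _ ≤ ∑ c ∈ S, |B| * k c * (1 / (s₀ + 1)) := by
                refine Finset.sum_le_sum fun c hc => ?_
                simp only [Function.comp_apply, norm_mul]
                calc ‖α c v‖ * ‖T v‖ * c.weight Γ (y v)
                    ≤ |B| * (1 / (s₀ + 1)) * k c := by
                      have := c.weight_nonneg hΓ0 (y v)
                      gcongr
                      · exact (hαB c hc v hsR).trans (le_abs_self B)
                      · exact hTv.trans (min_le_right _ _)
                      · exact hk c _ (hyle v hs')
                  _ = _ := by ring
            _ = s₀ / (s₀ + 1) := by rw [← Finset.sum_mul, ← hs₀]; ring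
            _ ≤ 1 := div_le_one_of_le₀ (by linarith) (by linarith)
      · intro s hs s' hs'
        refine (norm_sub_le_of_near_const hy hr' hδ0.le hnear (hsw s' hs') (hsw s hs)).trans ?_
        rw [← sub_smul, norm_smul, Real.norm_eq_abs]
        calc δ / (r' - r) * (|s' - s| * ‖w‖) ≤ δ / (r' - r) * (|s' - s| * r) := by gcongr
          _ = _ := by ring
  · intro e he
    rcases List.mem_cons.1 he with rfl | he
    · exact Finset.mem_insert_self _ _
    · obtain ⟨c, hc, rfl⟩ := List.mem_map.1 he
      exact Finset.mem_insert_of_mem (Finset.mem_toList.1 hc)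
  · intro e he w hw
    rcases List.mem_cons.1 he with rfl | he
    · exact (hM₁ w hw).trans (le_add_of_nonneg_right (by positivity))
    · obtain ⟨c, hc, rfl⟩ := List.mem_map.1 he
      simp only [norm_mul]
      refine le_trans ?_ (le_add_of_nonneg_left hM₁0)
      exact mul_le_mul ((hαB c (Finset.mem_toList.1 hc) w hw).trans (le_abs_self B)) (hM₂ w hw)
        (norm_nonneg _) (abs_nonneg _)
  · intro w hw
    have hsum : (L.map fun e => e.2.1 w * e.1.det (y w)).sum - 1 =
        T w * (∑ c ∈ S, α c w * c.det (y w) - 1) := by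
      rw [hL, List.map_cons, List.sum_cons, List.map_map]
      have h1 := Finset.sum_map_toList S fun c => α c w * T w * c.det (y w)
      have h2 : ∑ c ∈ S, α c w * T w * c.det (y w) = T w * ∑ c ∈ S, α c w * c.det (y w) := by
        rw [Finset.mul_sum]
        exact Finset.sum_congr rfl fun c _ => by ring
      have h3 : F w * c₀.det (y w) = 1 - T w := by simp [hT]
      rw [h2] at h1
      simp only [Function.comp_def]
      rw [h1, h3]
      ring
    rw [hsum, norm_mul]
    calc _ ≤ M₂ * (η / (M₂ + 1)) :=
          mul_le_mul (hM₂ w hw) (hα' w hw) (norm_nonneg _) hM₂0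
      _ = η * (M₂ / (M₂ + 1)) := by ring
      _ ≤ η * 1 := by
          gcongr
          exact div_le_one_of_le₀ (by linarith) (by linarith)
      _ = η := mul_one η

end Contraction

section Correction

/-- Reparametrization of a family of automorphisms. -/
def AutFamily.pullback {V W X : Type*} [NormedAddCommGroup V] [NormedSpace ℂ V]
    [NormedAddCommGroup W] [NormedSpace ℂ W] [NormedAddCommGroup X] [NormedSpace ℂ X]
    (f : AutFamily V X) (φ : W → V) (hφ : Differentiable ℂ φ) : AutFamily W X where
  toFun w z := f.toFun (φ w) z
  inv w z := f.inv (φ w) z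
  differentiable_toFun := f.differentiable_toFun.comp
    ((hφ.comp differentiable_fst).prodMk differentiable_snd)
  differentiable_inv := f.differentiable_inv.comp
    ((hφ.comp differentiable_fst).prodMk differentiable_snd)
  left_inv w := f.left_inv (φ w)
  right_inv w := f.right_inv (φ w)

variable {ι X : Type*} [Fintype ι] [DecidableEq ι] [NormedAddCommGroup X] [NormedSpace ℂ X]

namespace FormPair

/-- Automorphisms, parametrized by a configuration `y` and a scalar `q`, that map `y` to `xh`
when `q` is the inverse of `sepDet c.lam y`. -/
noncomputable def correction (c : FormPair X) (xh : ι → X) : AutFamily ((ι → X) × ℂ) X :=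
  (AutFamily.shear c.mu (fun _ => xh)
    (fun p i => (sepDet c.mu xh)⁻¹ • c.projVec (xh i - p.1 i)) (differentiable_const _)
    (by fun_prop) (fun p i => by simp [c.mu_projVec])).comp
  (AutFamily.shear c.lam Prod.fst (fun p i => p.2 • c.projLam (xh i - p.1 i)) differentiable_fst
    (by fun_prop) (fun p i => by simp [c.lam_projLam]))

theorem correction_apply_self (c : FormPair X) {xh y : ι → X} (hxh : sepDet c.mu xh ≠ 0)
    (hy : sepDet c.lam y ≠ 0) (i : ι) :
    (c.correction xh).toFun (y, (sepDet c.lam y)⁻¹) (y i) = xh i := by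
  simp only [correction, AutFamily.comp, AutFamily.shear, shearVec_self, smul_smul,
    mul_inv_cancel₀ hy, one_smul]
  have h := c.projLam_add_projVec (xh i - y i)
  have hmu : c.mu (y i + c.projLam (xh i - y i)) = c.mu (xh i) := by
    have := congrArg c.mu h
    rw [map_add, c.mu_projVec, add_zero, c.mu.map_sub] at this
    rw [map_add, this]
    ring
  rw [shearVec_congr _ _ _ hmu, shearVec_self, smul_smul, mul_inv_cancel₀ hxh, one_smul,
    add_assoc, h]
  abel

theorem correction_self (c : FormPair X) (xh : ι → X) (q : ℂ) (z : X) :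
    (c.correction xh).toFun (xh, q) z = z ∧ (c.correction xh).inv (xh, q) z = z := by
  have h : (fun _ : ι => (0 : X)) = 0 := rfl
  simp [correction, AutFamily.comp, AutFamily.shear, h, shearVec_zero]

/-- The correction of a configuration close to `xh` is close to the identity. -/
theorem exists_nearId_correction [ProperSpace X] (c : FormPair X) {xh : ι → X}
    (hxh : sepDet c.lam xh ≠ 0) (ρ : ℝ) {D : ℝ} (hD : 0 < D) :
    ∃ ε > 0, ∀ y : ι → X, ‖y - xh‖ ≤ ε → sepDet c.lam y ≠ 0 ∧
      (c.correction xh).NearId (y, (sepDet c.lam y)⁻¹) ρ D := by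
  set q := ‖sepDet c.lam xh‖ with hq
  have hq0 : 0 < q := norm_pos_iff.2 hxh
  obtain ⟨δ, hδ0, hδ⟩ := Metric.continuousAt_iff.1
    ((differentiable_sepDet c.lam).continuous.continuousAt (x := xh)) (q / 2) (by positivity)
  set M := max (max ρ (‖xh‖ + 1)) (2 / q) with hM
  obtain ⟨C₁, hC₁0, hC₁⟩ := exists_lipschitz_closedBall (c.correction xh).differentiable_toFun M
  obtain ⟨C₂, hC₂0, hC₂⟩ := exists_lipschitz_closedBall (c.correction xh).differentiable_inv M
  set ε := min (min 1 (δ / 2)) (D / (C₁ + C₂ + 1)) with hε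
  refine ⟨ε, by positivity, fun y hy => ?_⟩
  have hε1 : ε ≤ 1 := (min_le_left _ _).trans (min_le_left _ _)
  have hε2 : ε ≤ δ / 2 := (min_le_left _ _).trans (min_le_right _ _)
  have hε3 : ε * (C₁ + C₂ + 1) ≤ D := (le_div_iff₀ (by positivity)).1 (min_le_right _ _)
  have hdet : q / 2 ≤ ‖sepDet c.lam y‖ := by
    have h1 := hδ (x := y) (by rw [dist_eq_norm]; linarith)
    rw [dist_eq_norm] at h1
    linarith [norm_le_norm_add_norm_sub (sepDet c.lam y) (sepDet c.lam xh)]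
  have hdet0 : sepDet c.lam y ≠ 0 := norm_pos_iff.1 (lt_of_lt_of_le (by positivity) hdet)
  refine ⟨hdet0, fun z hz => ?_⟩
  set t := (sepDet c.lam y)⁻¹
  have ht : ‖t‖ ≤ M := by
    refine le_trans ?_ (le_max_right _ _)
    rw [norm_inv, inv_le_comm₀ (by linarith) (by positivity), inv_div]
    exact hdet
  have hyM : ‖y‖ ≤ M := by
    refine le_trans ?_ ((le_max_right _ _).trans (le_max_left _ _))
    have := norm_le_norm_add_norm_sub xh y
    rw [norm_sub_rev] at this
    linarith
  have hxM : ‖xh‖ ≤ M :=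
    (le_add_of_nonneg_right zero_le_one).trans ((le_max_right _ _).trans (le_max_left _ _))
  have hzM : ‖z‖ ≤ M := by
    refine le_trans ?_ ((le_max_left _ _).trans (le_max_left _ _))
    linarith
  have hpt : ∀ u : ι → X, ‖u‖ ≤ M → ‖((u, t), z)‖ ≤ M := fun u hu => by
    simp only [Prod.norm_mk, sup_le_iff]
    exact ⟨⟨hu, ht⟩, hzM⟩
  have hdist : ‖((y, t), z) - ((xh, t), z)‖ = ‖y - xh‖ := by
    simp [Prod.norm_mk]
  have h1 := hC₁ _ _ (hpt y hyM) (hpt xh hxM)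
  have h2 := hC₂ _ _ (hpt y hyM) (hpt xh hxM)
  simp only [hdist, (c.correction_self xh t z).1, (c.correction_self xh t z).2] at h1 h2
  have hε0 : 0 ≤ ε := by positivity
  have h3 : C₁ * ‖y - xh‖ ≤ C₁ * ε := by gcongr
  have h4 : C₂ * ‖y - xh‖ ≤ C₂ * ε := by gcongr
  constructor <;> nlinarith

end FormPair

end Correction

section Step

variable {ι W X : Type*} [Fintype ι] [DecidableEq ι] [NormedAddCommGroup W] [NormedSpace ℂ W]
  [NormedAddCommGroup X] [NormedSpace ℂ X]

namespace AutFamily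

/-- The image of a moving configuration. -/
def config (f : AutFamily W X) (x : W → ι → X) (w : W) (i : ι) : X := f.toFun w (x w i)

/-- The factor `sepDet c.lam` of the image of a moving configuration. -/
noncomputable def configDet (f : AutFamily W X) (c : FormPair X) (x : W → ι → X) (w : W) : ℂ :=
  sepDet c.lam (f.config x w)

theorem differentiable_configDet (f : AutFamily W X) (c : FormPair X) {x : W → ι → X}
    (hx : Differentiable ℂ x) : Differentiable ℂ (f.configDet c x) :=
  Differentiable.comp (g := sepDet c.lam) (differentiable_sepDet c.lam) (f.differentiable_config hx)

/-- A family followed by the corrections of the images of `x`, with a free scalar parameter. -/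
noncomputable def corrected (f : AutFamily W X) (c : FormPair X) (xh : ι → X) {x : W → ι → X}
    (hx : Differentiable ℂ x) : AutFamily (W × ℂ) X :=
  ((c.correction xh).pullback (fun p : W × ℂ => (f.config x p.1, p.2))
    (((f.differentiable_config hx).comp differentiable_fst).prodMk differentiable_snd)).comp
  (f.pullback Prod.fst differentiable_fst)

theorem corrected_apply (f : AutFamily W X) (c : FormPair X) {xh : ι → X} {x : W → ι → X}
    (hx : Differentiable ℂ x) (hxh : sepDet c.mu xh ≠ 0) {w : W} (hw : f.configDet c x w ≠ 0)
    (i : ι) : (f.corrected c xh hx).toFun (w, (f.configDet c x w)⁻¹) (x w i) = xh i :=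
  c.correction_apply_self hxh hw i

end AutFamily

end Step

section StepTheorem

variable {ι X : Type*} [Fintype ι] [DecidableEq ι] {m : ℕ} [NormedAddCommGroup X]
  [NormedSpace ℂ X] [FiniteDimensional ℂ X] [ProperSpace X]

/-- A family that can be corrected over a ball is approximated, on a smaller ball and after
correction, by a family that can be corrected over a larger ball. -/
theorem AutFamily.exists_approx_corrected (hX : 2 ≤ Module.finrank ℂ X) {xh : ι → X}
    (hxh : Function.Injective xh) {c : FormPair X} (hlam : sepDet c.lam xh ≠ 0)
    (hmu : sepDet c.mu xh ≠ 0) {x : EuclideanSpace ℂ (Fin m) → ι → X} (hx : Differentiable ℂ x)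
    (hinj : ∀ w, Function.Injective (x w)) (f : AutFamily (EuclideanSpace ℂ (Fin m)) X)
    {r r' R : ℝ} (hr : 0 ≤ r) (hr' : r < r') (hR : r' ≤ R) (ρ : ℝ) {ε : ℝ} (hε : 0 < ε)
    (hf : ∀ w ∈ closedBall 0 r', f.configDet c x w ≠ 0) :
    ∃ g : AutFamily (EuclideanSpace ℂ (Fin m)) X,
      (∀ w ∈ closedBall 0 R, g.configDet c x w ≠ 0) ∧
      ∀ w ∈ closedBall 0 r, ∀ z, ‖z‖ ≤ ρ →
        ‖(g.corrected c xh hx).toFun (w, (g.configDet c x w)⁻¹) z -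
          (f.corrected c xh hx).toFun (w, (f.configDet c x w)⁻¹) z‖ ≤ ε ∧
        ‖(g.corrected c xh hx).inv (w, (g.configDet c x w)⁻¹) z -
          (f.corrected c xh hx).inv (w, (f.configDet c x w)⁻¹) z‖ ≤ ε := by
  have hr'0 : 0 ≤ r' := hr.trans hr'.le
  have hdf := f.differentiable_configDet c hx
  set F := f.corrected c xh hx with hF
  obtain ⟨Q, hQ⟩ := (isCompact_closedBall (0 : EuclideanSpace ℂ (Fin m))
    r').exists_bound_of_continuousOn (hdf.continuous.continuousOn.inv₀ hf)
  have hQ0 : 0 ≤ Q := (norm_nonneg _).trans (hQ 0 (by simpa using hr'0))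
  obtain ⟨M, hM⟩ := (isCompact_closedBall (0 : EuclideanSpace ℂ (Fin m))
    r').exists_bound_of_continuousOn hx.continuous.continuousOn
  have hM0 : 0 ≤ M := (norm_nonneg _).trans (hM 0 (by simpa using hr'0))
  set b := r' + (Q + 1) + |ρ| + M + 1 with hb
  have hρ := le_abs_self ρ
  have hρ0 := abs_nonneg ρ
  obtain ⟨C₁, hC₁0, hC₁⟩ := exists_lipschitz_closedBall F.differentiable_toFun b
  obtain ⟨C₂, hC₂0, hC₂⟩ := exists_lipschitz_closedBall F.differentiable_inv b
  obtain ⟨T, hT⟩ := (isCompact_closedBall (0 : (EuclideanSpace ℂ (Fin m) × ℂ) × X)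
    b).exists_bound_of_continuousOn F.differentiable_toFun.continuous.continuousOn
  set ρ' := max T ρ + 1 with hρ'
  set D := min (min (1 / 2) (ε / 4)) (ε / (2 * (C₂ + 1))) with hD
  have hD0 : 0 < D := by positivity
  have hD1 : D ≤ 1 / 2 := (min_le_left _ _).trans (min_le_left _ _)
  have hD2 : D ≤ ε / 4 := (min_le_left _ _).trans (min_le_right _ _)
  have hD3 : C₂ * (D + D) ≤ ε := by
    have := (le_div_iff₀ (by positivity)).1 (min_le_right _ _ : D ≤ ε / (2 * (C₂ + 1)))
    linarith
  obtain ⟨ε', hε'0, hε'⟩ := c.exists_nearId_correction hlam ρ' hD0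
  obtain ⟨δ, hδ0, hδ⟩ := exists_autFamily_contraction (m := m) hX hxh hr hr' hR
    (ε := min ε' D) (by positivity) ρ'
  set η := min (min 1 (min δ (ε / 2) / (C₁ + 1))) (ε / (C₂ + 1)) with hη
  have hη0 : 0 < η := by positivity
  have hη1 : η ≤ 1 := (min_le_left _ _).trans (min_le_left _ _)
  have hη2 : C₁ * η ≤ min δ (ε / 2) := by
    have := (le_div_iff₀ (by positivity)).1
      ((min_le_left _ _).trans (min_le_right _ _) : η ≤ min δ (ε / 2) / (C₁ + 1))
    linarith
  have hη3 : C₂ * η ≤ ε := by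
    have := (le_div_iff₀ (by positivity)).1 (min_le_right _ _ : η ≤ ε / (C₂ + 1))
    linarith
  obtain ⟨q, hq, hq'⟩ := exists_entire_approx_inv hr'0 hdf hf (ε := η / (Q + 1)) (by positivity)
  have hqη : ∀ w ∈ closedBall 0 r', ‖q w - (f.configDet c x w)⁻¹‖ ≤ η := fun w hw => by
    have h0 := hf w hw
    have h1 : q w - (f.configDet c x w)⁻¹ =
        (q w * f.configDet c x w - 1) * (f.configDet c x w)⁻¹ := by
      field_simp
    rw [h1, norm_mul]
    calc _ ≤ η / (Q + 1) * Q := mul_le_mul (hq' w hw) (hQ w hw) (norm_nonneg _) (by positivity)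
      _ = η * (Q / (Q + 1)) := by ring
      _ ≤ η * 1 := by
          gcongr
          exact div_le_one_of_le₀ (by linarith) (by linarith)
      _ = η := mul_one η
  have hqb : ∀ w ∈ closedBall 0 r', ‖q w‖ ≤ b ∧ ‖(f.configDet c x w)⁻¹‖ ≤ b := fun w hw => by
    have h1 := hqη w hw
    have h2 := hQ w hw
    rw [Pi.inv_apply] at h2
    have h3 := norm_le_norm_add_norm_sub (f.configDet c x w)⁻¹ (q w)
    rw [norm_sub_rev] at h3
    exact ⟨by linarith, by linarith⟩
  have hwb : ∀ w ∈ closedBall (0 : EuclideanSpace ℂ (Fin m)) r', ‖w‖ ≤ b := fun w hw => by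
    rw [mem_closedBall_zero_iff] at hw
    linarith
  have hFη : ∀ w ∈ closedBall 0 r', ∀ z, ‖z‖ ≤ b →
      ‖F.toFun (w, q w) z - F.toFun (w, (f.configDet c x w)⁻¹) z‖ ≤ C₁ * η := by
    intro w hw z hz
    refine (hC₁ ((w, q w), z) ((w, (f.configDet c x w)⁻¹), z) ?_ ?_).trans ?_
    · simp only [Prod.norm_mk, sup_le_iff]
      exact ⟨⟨hwb w hw, (hqb w hw).1⟩, hz⟩
    · simp only [Prod.norm_mk, sup_le_iff]
      exact ⟨⟨hwb w hw, (hqb w hw).2⟩, hz⟩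
    · gcongr
      simpa [Prod.norm_mk] using hqη w hw
  set f' : AutFamily (EuclideanSpace ℂ (Fin m)) X :=
    F.pullback (fun w => (w, q w)) (differentiable_id.prodMk hq) with hf'
  obtain ⟨κ, hκ, hκ'⟩ := hδ (f'.config x) (f'.differentiable_config hx)
    (fun w => (f'.injective w).comp (hinj w)) (fun w hw => by
      refine (pi_norm_le_iff_of_nonneg hδ0.le).2 fun i => ?_
      have h1 := hFη w hw (x w i) (by linarith [(norm_le_pi_norm (x w) i).trans (hM w hw)])
      rw [hF, f.corrected_apply c hx hmu (hf w hw) i] at h1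
      exact h1.trans (hη2.trans (min_le_left _ _)))
  have hconf : ∀ w ∈ closedBall 0 R, ‖(κ.comp f').config x w - xh‖ ≤ ε' := fun w hw =>
    (pi_norm_le_iff_of_nonneg hε'0.le).2 fun i => (hκ w hw i).trans (min_le_left _ _)
  refine ⟨κ.comp f', fun w hw => (hε' _ (hconf w hw)).1, fun w hw z hz => ?_⟩
  have hwr' : w ∈ closedBall (0 : EuclideanSpace ℂ (Fin m)) r' :=
    closedBall_subset_closedBall hr'.le hw
  have hwR := closedBall_subset_closedBall hR hwr'
  set g := κ.comp f' with hg
  set u : (ι → X) × ℂ := (g.config x w, (g.configDet c x w)⁻¹) with hu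
  have hN₁ : ((c.correction xh).pullback (fun _ : EuclideanSpace ℂ (Fin m) => u)
      (differentiable_const _)).NearId w ρ' D := (hε' _ (hconf w hwR)).2
  have hN := hN₁.comp ((hκ' w hw).mono (min_le_right _ _)) hD0.le hD0.le
  have hTρ : T ≤ max T ρ := le_max_left _ _
  have hρρ : ρ ≤ max T ρ := le_max_right _ _
  constructor
  · have hFb : ‖F.toFun (w, q w) z‖ ≤ T := hT ((w, q w), z) (by
      rw [mem_closedBall_zero_iff]
      simp only [Prod.norm_mk, sup_le_iff]
      exact ⟨⟨hwb w hwr', (hqb w hwr').1⟩, by linarith⟩)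
    have h1 := (hN (F.toFun (w, q w) z) (by linarith)).1
    have h2 := hFη w hwr' z (by linarith)
    calc _ ≤ (D + D) + C₁ * η := (norm_sub_le_norm_sub_add_norm_sub _ _ _).trans (add_le_add h1 h2)
      _ ≤ ε := by linarith [hη2.trans (min_le_right _ _)]
  · have h1 := (hN z (by linarith)).2
    set z' := (((c.correction xh).pullback (fun _ : EuclideanSpace ℂ (Fin m) => u)
      (differentiable_const _)).comp κ).inv w z with hz'
    have hz'b : ‖z'‖ ≤ b := by
      have := norm_le_norm_add_norm_sub z z'
      rw [norm_sub_rev] at this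
      linarith
    refine (hC₂ ((w, q w), z') ((w, (f.configDet c x w)⁻¹), z) ?_ ?_).trans ?_
    · simp only [Prod.norm_mk, sup_le_iff]
      exact ⟨⟨hwb w hwr', (hqb w hwr').1⟩, hz'b⟩
    · simp only [Prod.norm_mk, sup_le_iff]
      exact ⟨⟨hwb w hwr', (hqb w hwr').2⟩, by linarith⟩
    · calc _ ≤ C₂ * max η (D + D) := by
            gcongr
            simp only [Prod.mk_sub_mk, Prod.norm_mk, sub_self, norm_zero]
            rw [max_eq_right (norm_nonneg _)]
            exact max_le_max (hqη w hwr') h1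
        _ ≤ ε := by
            rw [mul_max_of_nonneg _ _ hC₂0]
            exact max_le hη3 hD3

end StepTheorem

section Limit

variable {E F : Type*} [NormedAddCommGroup E] [NormedAddCommGroup F]

/-- Convergence, uniform on balls, of a sequence with geometrically small increments. -/
theorem exists_tendstoUniformlyOn_ball [CompleteSpace F] {u : ℕ → E → F}
    (h : ∀ (k : ℕ) (p : E), ‖p‖ ≤ k / 2 → ‖u (k + 1) p - u k p‖ ≤ (1 / 2) ^ k) :
    ∃ v : E → F, ∀ M : ℝ, TendstoUniformlyOn u v atTop (ball 0 M) := by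
  have hstep : ∀ (k : ℕ) (p : E), ‖p‖ ≤ k / 2 → ∀ n,
      dist (u (n + k) p) (u (n + 1 + k) p) ≤ (1 / 2) ^ k * (1 / 2) ^ n := fun k p hp n => by
    rw [dist_comm, dist_eq_norm, show n + 1 + k = n + k + 1 by omega, ← pow_add, add_comm k n]
    refine h _ p (hp.trans ?_)
    push_cast
    linarith [(Nat.cast_nonneg n : (0 : ℝ) ≤ n)]
  have hlim : ∀ p, ∃ l, Tendsto (fun k => u k p) atTop (𝓝 l) := fun p => by
    obtain ⟨k, hk⟩ := exists_nat_ge (2 * ‖p‖)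
    obtain ⟨l, hl⟩ := cauchySeq_tendsto_of_complete
      (cauchySeq_of_le_geometric _ _ (by norm_num) (hstep k p (by linarith)))
    exact ⟨l, (tendsto_add_atTop_iff_nat k).1 hl⟩
  choose v hv using hlim
  refine ⟨v, fun M => Metric.tendstoUniformlyOn_iff.2 fun ε hε => ?_⟩
  obtain ⟨k₀, hk₀⟩ := exists_pow_lt_of_lt_one (half_pos hε) (one_half_lt_one (α := ℝ))
  obtain ⟨k₁, hk₁⟩ := exists_nat_ge (2 * M)
  filter_upwards [eventually_ge_atTop (max k₀ k₁)] with k hk p hp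
  rw [mem_ball_zero_iff] at hp
  have hkk : (k₁ : ℝ) ≤ k := by exact_mod_cast (le_max_right _ _).trans hk
  have h1 := dist_le_of_le_geometric_of_tendsto₀ _ _ (by norm_num) (hstep k p (by linarith))
    ((tendsto_add_atTop_iff_nat k).2 (hv p))
  rw [zero_add] at h1
  have h2 : (1 / 2 : ℝ) ^ k ≤ (1 / 2) ^ k₀ :=
    pow_le_pow_of_le_one (by norm_num) (by norm_num) ((le_max_left _ _).trans hk)
  rw [dist_comm]
  calc _ ≤ (1 / 2 : ℝ) ^ k / (1 - 1 / 2) := h1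
    _ = 2 * (1 / 2) ^ k := by ring
    _ < ε := by linarith

theorem tendsto_comp_of_tendstoUniformlyOn_ball {u : ℕ → E → F} {v : E → F}
    (h : ∀ M : ℝ, TendstoUniformlyOn u v atTop (ball 0 M)) (hv : Continuous v) {g : ℕ → E} {a : E}
    (hg : Tendsto g atTop (𝓝 a)) : Tendsto (fun k => u k (g k)) atTop (𝓝 (v a)) :=
  tendsto_comp_of_locally_uniform_limit hv.continuousAt hg fun s hs =>
    ⟨ball 0 (‖a‖ + 1), isOpen_ball.mem_nhds (by simp), h _ s hs⟩

theorem differentiable_of_tendstoUniformlyOn_ball [NormedSpace ℂ E] [NormedSpace ℂ F]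
    [CompleteSpace F] {u : ℕ → E → F} {v : E → F}
    (h : ∀ M : ℝ, TendstoUniformlyOn u v atTop (ball 0 M))
    (hu : ∀ (k : ℕ) (p : E), ‖p‖ ≤ k → DifferentiableAt ℂ (u k) p) : Differentiable ℂ v := by
  intro p
  have hsub : ball p 1 ⊆ ball 0 (‖p‖ + 1) := fun q hq => by
    rw [mem_ball_zero_iff]
    rw [mem_ball_iff_norm'] at hq
    linarith [norm_le_norm_add_norm_sub p q]
  refine differentiableAt_of_tendstoUniformlyOn one_pos ?_ ((h (‖p‖ + 1)).mono hsub)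
  obtain ⟨k₀, hk₀⟩ := exists_nat_ge (‖p‖ + 1)
  filter_upwards [eventually_ge_atTop k₀] with k hk q hq
  have hkk : (k₀ : ℝ) ≤ k := by exact_mod_cast hk
  have := hsub hq
  rw [mem_ball_zero_iff] at this
  exact hu k q (by linarith)

end Limit

section Interpolation

variable {ι X : Type*} [Fintype ι] [DecidableEq ι] {m : ℕ} [NormedAddCommGroup X]
  [NormedSpace ℂ X] [FiniteDimensional ℂ X] [ProperSpace X]

/-- A sequence of families whose corrections converge rapidly. -/
theorem exists_seq_corrected (hX : 2 ≤ Module.finrank ℂ X) {xh : ι → X}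
    (hxh : Function.Injective xh) {c : FormPair X} (hlam : sepDet c.lam xh ≠ 0)
    (hmu : sepDet c.mu xh ≠ 0) {x : EuclideanSpace ℂ (Fin m) → ι → X} (hx : Differentiable ℂ x)
    (hinj : ∀ w, Function.Injective (x w)) (h0 : sepDet c.lam (x 0) ≠ 0) :
    ∃ f : ℕ → AutFamily (EuclideanSpace ℂ (Fin m)) X,
      (∀ (k : ℕ) w, ‖w‖ ≤ k → (f k).configDet c x w ≠ 0) ∧
      ∀ (k : ℕ) w z, ‖w‖ ≤ k / 2 → ‖z‖ ≤ k / 2 →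
        ‖((f (k + 1)).corrected c xh hx).toFun (w, ((f (k + 1)).configDet c x w)⁻¹) z -
          ((f k).corrected c xh hx).toFun (w, ((f k).configDet c x w)⁻¹) z‖ ≤ (1 / 2) ^ k ∧
        ‖((f (k + 1)).corrected c xh hx).inv (w, ((f (k + 1)).configDet c x w)⁻¹) z -
          ((f k).corrected c xh hx).inv (w, ((f k).configDet c x w)⁻¹) z‖ ≤ (1 / 2) ^ k := by
  obtain ⟨r, hr, hr'⟩ : ∃ r > 0, ∀ w ∈ closedBall (0 : EuclideanSpace ℂ (Fin m)) r,
      AutFamily.id.configDet c x w ≠ 0 :=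
    Metric.nhds_basis_closedBall.eventually_iff.1
      (((AutFamily.id.differentiable_configDet c hx).continuous.continuousAt).eventually_ne h0)
  have hstep : ∀ (k : ℕ) (f : {f : AutFamily (EuclideanSpace ℂ (Fin m)) X //
        ∀ w ∈ closedBall 0 (r + k), f.configDet c x w ≠ 0}),
      ∃ g : {f : AutFamily (EuclideanSpace ℂ (Fin m)) X //
        ∀ w ∈ closedBall 0 (r + (k + 1 : ℕ)), f.configDet c x w ≠ 0},
      ∀ w z, ‖w‖ ≤ k / 2 → ‖z‖ ≤ k / 2 →
        ‖(g.1.corrected c xh hx).toFun (w, (g.1.configDet c x w)⁻¹) z -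
          (f.1.corrected c xh hx).toFun (w, (f.1.configDet c x w)⁻¹) z‖ ≤ (1 / 2) ^ k ∧
        ‖(g.1.corrected c xh hx).inv (w, (g.1.configDet c x w)⁻¹) z -
          (f.1.corrected c xh hx).inv (w, (f.1.configDet c x w)⁻¹) z‖ ≤ (1 / 2) ^ k := by
    intro k f
    have hk : (0 : ℝ) ≤ k := k.cast_nonneg
    obtain ⟨g, hg, hg'⟩ := AutFamily.exists_approx_corrected hX hxh hlam hmu hx hinj f.1
      (r := k / 2) (r' := r + k) (R := r + (k + 1 : ℕ)) (by positivity) (by linarith)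
      (by push_cast; linarith) (k / 2) (ε := (1 / 2) ^ k) (by positivity) f.2
    exact ⟨⟨g, hg⟩, fun w z hw hz => hg' w (by simpa using hw) z hz⟩
  choose next hnext using hstep
  let seq : ∀ k : ℕ, {f : AutFamily (EuclideanSpace ℂ (Fin m)) X //
      ∀ w ∈ closedBall 0 (r + k), f.configDet c x w ≠ 0} := fun k =>
    Nat.rec ⟨AutFamily.id, fun w hw => hr' w (by simpa using hw)⟩ next k
  refine ⟨fun k => (seq k).1, fun k w hw => (seq k).2 w ?_, fun k => hnext k (seq k)⟩
  rw [mem_closedBall_zero_iff]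
  linarith

/-- Parametric interpolation of moving configurations of distinct points. -/
theorem exists_parametric_interpolation (hX : 2 ≤ Module.finrank ℂ X) {xh : ι → X}
    (hxh : Function.Injective xh) {x : EuclideanSpace ℂ (Fin m) → ι → X}
    (hx : Differentiable ℂ x) (hinj : ∀ w, Function.Injective (x w)) :
    ∃ f : AutFamily (EuclideanSpace ℂ (Fin m)) X, ∀ w i, f.toFun w (xh i) = x w i := by
  have : CompleteSpace X := FiniteDimensional.complete ℂ X
  obtain ⟨c, hc, hc'⟩ := FormPair.exists_det_ne_zero hX hxh (hinj 0)
  obtain ⟨f, hf, hconv⟩ := exists_seq_corrected hX hxh (left_ne_zero_of_mul hc)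
    (right_ne_zero_of_mul hc) hx hinj (left_ne_zero_of_mul hc')
  set u : ℕ → EuclideanSpace ℂ (Fin m) × X → X := fun k p =>
    ((f k).corrected c xh hx).toFun (p.1, ((f k).configDet c x p.1)⁻¹) p.2 with hu
  set v : ℕ → EuclideanSpace ℂ (Fin m) × X → X := fun k p =>
    ((f k).corrected c xh hx).inv (p.1, ((f k).configDet c x p.1)⁻¹) p.2 with hv
  have hle : ∀ {p : EuclideanSpace ℂ (Fin m) × X} {t : ℝ}, ‖p‖ ≤ t → ‖p.1‖ ≤ t ∧ ‖p.2‖ ≤ t :=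
    fun hp => ⟨(norm_fst_le _).trans hp, (norm_snd_le _).trans hp⟩
  obtain ⟨ψ, hψ⟩ := exists_tendstoUniformlyOn_ball (u := u) fun k p hp =>
    (hconv k p.1 p.2 (hle hp).1 (hle hp).2).1
  obtain ⟨φ, hφ⟩ := exists_tendstoUniformlyOn_ball (u := v) fun k p hp =>
    (hconv k p.1 p.2 (hle hp).1 (hle hp).2).2
  have hpar : ∀ (k : ℕ) (p : EuclideanSpace ℂ (Fin m) × X), ‖p‖ ≤ k → DifferentiableAt ℂ
      (fun p : EuclideanSpace ℂ (Fin m) × X => ((p.1, ((f k).configDet c x p.1)⁻¹), p.2)) p :=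
    fun k p hp => (differentiableAt_fst.prodMk
      (((((f k).differentiable_configDet c hx).comp differentiable_fst) p).inv
        (hf k p.1 (hle hp).1))).prodMk differentiableAt_snd
  have hψd : Differentiable ℂ ψ := differentiable_of_tendstoUniformlyOn_ball hψ fun k p hp =>
    (((f k).corrected c xh hx).differentiable_toFun _).comp p (hpar k p hp)
  have hφd : Differentiable ℂ φ := differentiable_of_tendstoUniformlyOn_ball hφ fun k p hp =>
    (((f k).corrected c xh hx).differentiable_inv _).comp p (hpar k p hp)
  have hψt : ∀ p, Tendsto (fun k => u k p) atTop (𝓝 (ψ p)) := fun p =>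
    tendsto_comp_of_tendstoUniformlyOn_ball hψ hψd.continuous tendsto_const_nhds
  have hφt : ∀ p, Tendsto (fun k => v k p) atTop (𝓝 (φ p)) := fun p =>
    tendsto_comp_of_tendstoUniformlyOn_ball hφ hφd.continuous tendsto_const_nhds
  have hψφ : ∀ w z, ψ (w, φ (w, z)) = z := fun w z => by
    refine tendsto_nhds_unique (tendsto_comp_of_tendstoUniformlyOn_ball hψ hψd.continuous
      (tendsto_const_nhds.prodMk_nhds (hφt (w, z)))) ?_
    exact tendsto_const_nhds.congr fun k =>
      (((f k).corrected c xh hx).right_inv (w, ((f k).configDet c x w)⁻¹) z).symm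
  have hφψ : ∀ w z, φ (w, ψ (w, z)) = z := fun w z => by
    refine tendsto_nhds_unique (tendsto_comp_of_tendstoUniformlyOn_ball hφ hφd.continuous
      (tendsto_const_nhds.prodMk_nhds (hψt (w, z)))) ?_
    exact tendsto_const_nhds.congr fun k =>
      (((f k).corrected c xh hx).left_inv (w, ((f k).configDet c x w)⁻¹) z).symm
  have hψx : ∀ w i, ψ (w, x w i) = xh i := fun w i => by
    refine tendsto_nhds_unique (hψt (w, x w i)) ?_
    obtain ⟨k₀, hk₀⟩ := exists_nat_ge ‖w‖
    refine tendsto_const_nhds.congr' ?_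
    filter_upwards [eventually_ge_atTop k₀] with k hk
    have hkk : (k₀ : ℝ) ≤ k := by exact_mod_cast hk
    exact ((f k).corrected_apply c hx (right_ne_zero_of_mul hc) (hf k w (hk₀.trans hkk)) i).symm
  exact ⟨⟨fun w z => φ (w, z), fun w z => ψ (w, z), hφd, hψd, hψφ, hφψ⟩, fun w i => by
    rw [← hψx w i]
    exact hφψ w (x w i)⟩

end Interpolation

/-- parametric point interpolation (Kutzschebauch–Ramos-Peon) for `X = ℂⁿ`
(n ≥ 2) with parameter space `W = ℂ^m`: given holomorphic maps `x₁,…,x_N : ℂ^m → ℂⁿ`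
with pairwise distinct values, there is a holomorphic family of holomorphic automorphisms
`α(w,·)` of `ℂⁿ` with `α(w, x̂ᵢ) = xᵢ(w)`. -/
theorem parametric_point_interpolation_Cm
    (m n N : ℕ) (hm : 1 ≤ m) (hn : 2 ≤ n) (hN : 1 ≤ N)
    (xh : Fin N → EuclideanSpace ℂ (Fin n)) (hxh : Function.Injective xh)
    (x : Fin N → EuclideanSpace ℂ (Fin m) → EuclideanSpace ℂ (Fin n))
    (hx : ∀ i, Differentiable ℂ (x i))
    (hx' : ∀ i j, i ≠ j → ∀ w, x i w ≠ x j w) :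
    ∃ α : EuclideanSpace ℂ (Fin m) × EuclideanSpace ℂ (Fin n) → EuclideanSpace ℂ (Fin n),
      Differentiable ℂ α ∧
      (∀ w, ∃ G : EuclideanSpace ℂ (Fin n) → EuclideanSpace ℂ (Fin n),
        Differentiable ℂ G ∧ (∀ z, G (α (w, z)) = z) ∧ (∀ z, α (w, G z) = z)) ∧
      (∀ i w, α (w, xh i) = x i w) := by
  obtain ⟨f, hf⟩ := exists_parametric_interpolation (X := EuclideanSpace ℂ (Fin n))
    (by simpa using hn) hxh (x := fun w i => x i w) (differentiable_pi.2 hx)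
    (fun w i j hij => by_contra fun h => hx' i j h w hij)
  exact ⟨fun p => f.toFun p.1 p.2, f.differentiable_toFun,
    fun w => ⟨f.inv w, f.differentiable_inv.comp ((differentiable_const w).prodMk differentiable_id),
      f.left_inv w, f.right_inv w⟩, fun i w => hf w i⟩
end

section
/- Fix integers n ≥ 2, N ≥ 1, and distinct points x̂₁, …, x̂_N ∈ ℂⁿ. Let W = ℂ \ {0} and let x_1, …, x_N : W → ℂⁿ be holomorphic maps such that x_i(w) ≠ x_j(w) for all w ∈ W whenever i ≠ j, and suppose the map x = (x_1, …, x_N) : W → (ℂⁿ)ᴺ \ Δ, where Δ is the union of all diagonals {z_i = z_j} for i < j, is null-homotopic, i.e. homotopic within (ℂⁿ)ᴺ \ Δ, through continuous maps, to a constant map. Then there exists a holomorphic map α : W × ℂⁿ → ℂⁿ such that for every w ∈ W the map α(w, ·) is a holomorphic automorphism of ℂⁿ and α(w, x̂_i) = x_i(w) for all i = 1, …, N and all w ∈ W. -/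
open Filter Topology

/-- A holomorphic function on a disc is a uniform limit of entire functions on the disc
of half the radius. -/
lemma exists_entire_approx_of_differentiableOn_ball {F : ℂ → ℂ} {R ε : ℝ} (hR : 0 < R)
    (hF : DifferentiableOn ℂ F (Metric.ball 0 R)) (hε : 0 < ε) :
    ∃ p : ℂ → ℂ, Differentiable ℂ p ∧ ∀ w, ‖w‖ ≤ R / 2 → ‖F w - p w‖ ≤ ε := by
  lift R to NNReal using hR.le
  have hR' : 0 < R := by exact_mod_cast hR
  have h := (hF.mono (Metric.closedBall_subset_ball (ε₂ := R) (ε₁ := ((3 / 4 * R : NNReal) : ℝ))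
    (by push_cast; linarith))).hasFPowerSeriesOnBall (by positivity)
  have hu := h.tendstoUniformlyOn (r' := 2 / 3 * R)
    (by
      rw [ENNReal.coe_lt_coe, ← NNReal.coe_lt_coe]
      push_cast
      linarith)
  rw [Metric.tendstoUniformlyOn_iff] at hu
  obtain ⟨k, hk⟩ := (hu ε hε).exists
  refine ⟨fun w => (cauchyPowerSeries F 0 ((3 / 4 * R : NNReal) : ℝ)).partialSum k w, ?_, ?_⟩
  · simp only [FormalMultilinearSeries.partialSum,
      FormalMultilinearSeries.apply_eq_pow_smul_coeff]
    fun_prop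
  · intro w hw
    have := hk w (by
      simp only [Metric.mem_ball, dist_zero_right]
      push_cast; linarith)
    rw [dist_eq_norm, zero_add] at this
    exact this.le

/-- The principal part `Q(1 / (w - a))` is approximable by holomorphic functions on `ℂ \ {0}` on the
disc `‖w‖ ≤ ‖a‖ / 2` if `1 ≤ ‖a‖`, and on `2 * ‖a‖ ≤ ‖w‖` otherwise. -/
lemma exists_approx_principalPart (Q : Polynomial ℂ) {a : ℂ} (ha : a ≠ 0) {ε : ℝ} (hε : 0 < ε) :
    ∃ r : ℂ → ℂ, DifferentiableOn ℂ r {0}ᶜ ∧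
      ∀ w, (1 ≤ ‖a‖ ∧ ‖w‖ ≤ ‖a‖ / 2 ∨ ‖a‖ < 1 ∧ 2 * ‖a‖ ≤ ‖w‖) →
        ‖Q.eval (w - a)⁻¹ - r w‖ ≤ ε := by
  have ha' : 0 < ‖a‖ := norm_pos_iff.2 ha
  rcases le_or_gt 1 ‖a‖ with h1 | h1
  · obtain ⟨p, hp, hpa⟩ := exists_entire_approx_of_differentiableOn_ball
      (F := fun w => Q.eval (w - a)⁻¹) ha' (by
        intro w hw
        have : w - a ≠ 0 := by
          rintro h
          rw [sub_eq_zero] at h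
          simp [h] at hw
        have h2 : DifferentiableAt ℂ (fun w => (w - a)⁻¹) w := by fun_prop (disch := exact this)
        exact (Q.differentiable.differentiableAt.comp w h2).differentiableWithinAt) hε
    refine ⟨p, hp.differentiableOn, fun w hw => hpa w ?_⟩
    rcases hw with hw | hw
    · exact hw.2
    · linarith [hw.1]
  · obtain ⟨p, hp, hpa⟩ := exists_entire_approx_of_differentiableOn_ball
      (F := fun u => Q.eval (u * (1 - a * u)⁻¹)) (R := ‖a‖⁻¹) (by positivity) (by
        intro w hw
        have : 1 - a * w ≠ 0 := by
          rintro h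
          rw [sub_eq_zero] at h
          have h3 := congrArg norm h
          rw [norm_mul, norm_one] at h3
          simp only [Metric.mem_ball, dist_zero_right] at hw
          have := mul_lt_mul_of_pos_left hw ha'
          rw [← h3, mul_inv_cancel₀ ha'.ne'] at this
          exact lt_irrefl _ this
        have h2 : DifferentiableAt ℂ (fun w => w * (1 - a * w)⁻¹) w := by
          fun_prop (disch := exact this)
        exact (Q.differentiable.differentiableAt.comp w h2).differentiableWithinAt) hε
    refine ⟨fun w => p w⁻¹, fun w hw => ?_, fun w hw => ?_⟩
    · have : w ≠ 0 := hw
      exact (hp.differentiableAt.comp w (differentiableAt_inv this)).differentiableWithinAt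
    · have hw' : 2 * ‖a‖ ≤ ‖w‖ := by
        rcases hw with hw | hw
        · linarith [hw.1]
        · exact hw.2
      have hw0 : w ≠ 0 := norm_pos_iff.1 (by linarith)
      have hwa : w - a ≠ 0 := by
        intro h
        rw [sub_eq_zero] at h
        rw [h] at hw'
        linarith
      have key := hpa w⁻¹ (by
        rw [norm_inv]
        have : ‖w‖⁻¹ ≤ (2 * ‖a‖)⁻¹ := inv_anti₀ (by positivity) hw'
        rw [mul_inv] at this
        linarith)
      have e : w⁻¹ * (1 - a * w⁻¹)⁻¹ = (w - a)⁻¹ := by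
        rw [← mul_inv]
        congr 1
        field_simp
      rwa [e] at key

/-- A set without accumulation points in `ℂ \ {0}` meets each closed annulus in a finite set. -/
lemma finite_inter_annulus {A : Set ℂ} (hA : ∀ z : ℂ, z ≠ 0 → ∀ᶠ w in 𝓝[≠] z, w ∉ A)
    {r R : ℝ} (hr : 0 < r) : {a ∈ A | r ≤ ‖a‖ ∧ ‖a‖ ≤ R}.Finite := by
  by_contra hinf
  have hK : IsCompact (Metric.closedBall (0 : ℂ) R ∩ {a : ℂ | r ≤ ‖a‖}) :=
    (isCompact_closedBall 0 R).inter_right (isClosed_le continuous_const continuous_norm)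
  obtain ⟨z, hz, hacc⟩ := Set.Infinite.exists_accPt_of_subset_isCompact hinf hK
    (fun a ha => ⟨by simpa using ha.2.2, ha.2.1⟩)
  have hz0 : z ≠ 0 := norm_pos_iff.1 (hr.trans_le hz.2)
  rw [accPt_iff_frequently_nhdsNE] at hacc
  exact hacc ((hA z hz0).mono fun w hw h => hw h.1)

lemma countable_of_discrete_punctured {A : Set ℂ} (hA0 : A ⊆ {0}ᶜ)
    (hA : ∀ z : ℂ, z ≠ 0 → ∀ᶠ w in 𝓝[≠] z, w ∉ A) : A.Countable := by
  have : A ⊆ ⋃ k : ℕ, {a ∈ A | ((k : ℝ) + 1)⁻¹ ≤ ‖a‖ ∧ ‖a‖ ≤ (k : ℝ) + 1} := by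
    intro a ha
    have ha' : 0 < ‖a‖ := norm_pos_iff.2 (hA0 ha)
    obtain ⟨k, hk⟩ := exists_nat_ge (max ‖a‖ ‖a‖⁻¹)
    refine Set.mem_iUnion.2 ⟨k, ha, ?_, ?_⟩
    · rw [inv_le_comm₀ (by positivity) ha']
      linarith [le_max_right ‖a‖ ‖a‖⁻¹]
    · linarith [le_max_left ‖a‖ ‖a‖⁻¹]
  exact (Set.countable_iUnion fun k =>
    (finite_inter_annulus hA (by positivity)).countable).mono this

/-- Mittag-Leffler theorem on the punctured plane. -/
lemma exists_mittagLeffler_punctured {A : Set ℂ} (hA0 : A ⊆ {0}ᶜ)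
    (hA : ∀ z : ℂ, z ≠ 0 → ∀ᶠ w in 𝓝[≠] z, w ∉ A) (Q : ℂ → Polynomial ℂ) :
    ∃ m : ℂ → ℂ, (∀ z, z ≠ 0 → z ∉ A → AnalyticAt ℂ m z) ∧
      ∀ a ∈ A, ∃ k : ℂ → ℂ, AnalyticAt ℂ k a ∧
        ∀ᶠ w in 𝓝 a, m w = (Q a).eval (w - a)⁻¹ + k w := by
  classical
  obtain ⟨ε, hε, c, hεc, -⟩ :=
    (countable_of_discrete_punctured hA0 hA).exists_pos_hasSum_le one_pos
  have hr : ∀ a : A, ∃ r : ℂ → ℂ, DifferentiableOn ℂ r {0}ᶜ ∧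
      ∀ w, (1 ≤ ‖(a : ℂ)‖ ∧ ‖w‖ ≤ ‖(a : ℂ)‖ / 2 ∨ ‖(a : ℂ)‖ < 1 ∧ 2 * ‖(a : ℂ)‖ ≤ ‖w‖) →
        ‖(Q a).eval (w - (a : ℂ))⁻¹ - r w‖ ≤ ε a :=
    fun a => exists_approx_principalPart (Q a) (hA0 a.2) (hε a)
  choose r hrd hrb using hr
  set t : A → ℂ → ℂ := fun a w => (Q a).eval (w - (a : ℂ))⁻¹ - r a w with ht
  have htd : ∀ (a : A) (w : ℂ), w ≠ 0 → w ≠ a → DifferentiableAt ℂ (t a) w := by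
    intro a w hw hwa
    have h2 : DifferentiableAt ℂ (fun w => (w - (a : ℂ))⁻¹) w := by
      fun_prop (disch := exact sub_ne_zero.2 hwa)
    exact ((Q a).differentiable.differentiableAt.comp w h2).sub
      ((hrd a).differentiableAt (isOpen_compl_singleton.mem_nhds hw))
  have key : ∀ z : ℂ, z ≠ 0 →
      AnalyticAt ℂ (fun w => ∑' a : A, if (a : ℂ) = z then 0 else t a w) z ∧
      ∀ᶠ w in 𝓝 z, Summable fun a : A => t a w := by
    intro z hz
    have hz' : 0 < ‖z‖ := norm_pos_iff.2 hz
    obtain ⟨δ, hδ, hδA⟩ := Metric.eventually_nhds_iff.1 (eventually_nhdsWithin_iff.1 (hA z hz))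
    set ρ := min (δ / 2) (‖z‖ / 2) with hρ
    have hρ0 : 0 < ρ := by positivity
    have hρδ : ρ < δ := (min_le_left _ _).trans_lt (by linarith)
    have hρz : ρ ≤ ‖z‖ / 2 := min_le_right _ _
    have hlow : ∀ w ∈ Metric.closedBall z ρ, ‖z‖ / 2 ≤ ‖w‖ := by
      intro w hw
      rw [mem_closedBall_iff_norm] at hw
      have := norm_sub_norm_le z w
      rw [norm_sub_rev] at this
      linarith
    have hup : ∀ w ∈ Metric.closedBall z ρ, ‖w‖ ≤ 2 * ‖z‖ := by
      intro w hw
      rw [mem_closedBall_iff_norm] at hw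
      have := norm_sub_norm_le w z
      linarith
    set u : A → ℂ → ℂ := fun a w => if (a : ℂ) = z then 0 else t a w with hu
    have hud : ∀ a, DifferentiableOn ℂ (u a) (Metric.closedBall z ρ) := by
      intro a w hw
      by_cases haz : (a : ℂ) = z
      · simp only [hu, haz, if_true]
        exact differentiableWithinAt_const _
      · simp only [hu, haz, if_false]
        refine (htd a w ?_ ?_).differentiableWithinAt
        · exact norm_pos_iff.1 (by linarith [hlow w hw])
        · rintro rfl
          exact hδA ((Metric.mem_closedBall.1 hw).trans_lt hρδ) haz a.2
    have hC : ∀ a, ∃ C, ∀ w ∈ Metric.closedBall z ρ, ‖u a w‖ ≤ C := fun a =>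
      (isCompact_closedBall z ρ).exists_bound_of_continuousOn (hud a).continuousOn
    choose C hC using hC
    set good : A → Prop := fun a => ∀ w ∈ Metric.closedBall z ρ,
      (1 ≤ ‖(a : ℂ)‖ ∧ ‖w‖ ≤ ‖(a : ℂ)‖ / 2 ∨ ‖(a : ℂ)‖ < 1 ∧ 2 * ‖(a : ℂ)‖ ≤ ‖w‖) with hgood
    have hfin : {a : A | ¬ good a}.Finite := by
      refine Set.Finite.of_finite_image (f := Subtype.val) ?_ Subtype.val_injective.injOn
      refine (finite_inter_annulus hA (r := min 1 (‖z‖ / 4)) (R := max 1 (4 * ‖z‖))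
        (by positivity)).subset ?_
      rintro _ ⟨a, ha, rfl⟩
      refine ⟨a.2, ?_⟩
      by_contra hcon
      refine ha fun w hw => ?_
      have h1 := hlow w hw
      have h2 := hup w hw
      rcases le_or_gt 1 ‖(a : ℂ)‖ with h | h
      · refine Or.inl ⟨h, ?_⟩
        by_contra h3
        exact hcon ⟨(min_le_left _ _).trans h, le_max_of_le_right (by linarith)⟩
      · refine Or.inr ⟨h, ?_⟩
        by_contra h3
        exact hcon ⟨(min_le_right _ _).trans (by linarith), le_max_of_le_left h.le⟩
    have hsum : Summable fun a : A => if good a then ε a else C a := by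
      refine hεc.summable.congr_cofinite ?_
      filter_upwards [hfin.compl_mem_cofinite] with a ha
      rw [if_pos (not_not.1 ha)]
    have hbound : ∀ (a : A), ∀ w ∈ Metric.closedBall z ρ,
        ‖u a w‖ ≤ if good a then ε a else C a := by
      intro a w hw
      split_ifs with hg
      · simp only [hu]
        split_ifs
        · simpa using (hε a).le
        · exact hrb a w (hg w hw)
      · exact hC a w hw
    refine ⟨?_, ?_⟩
    · exact (Complex.differentiableOn_tsum_of_summable_norm hsum
        (fun a => (hud a).mono Metric.ball_subset_closedBall) Metric.isOpen_ball
        (fun a w hw => hbound a w (Metric.ball_subset_closedBall hw))).analyticAt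
        (Metric.ball_mem_nhds z hρ0)
    · filter_upwards [Metric.closedBall_mem_nhds z hρ0] with w hw
      have h1 : Summable fun a => u a w := .of_norm_bounded hsum fun a => hbound a w hw
      refine h1.congr_cofinite ?_
      have : {a : A | (a : ℂ) = z}.Finite :=
        Set.Subsingleton.finite fun a ha b hb => Subtype.ext (ha.trans hb.symm)
      filter_upwards [this.compl_mem_cofinite] with a ha
      exact if_neg ha
  refine ⟨fun w => ∑' a : A, t a w, fun z hz hzA => ?_, fun a ha => ?_⟩
  · refine (key z hz).1.congr (Eventually.of_forall fun w => tsum_congr fun a => ?_)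
    exact if_neg fun h : (a : ℂ) = z => hzA (h ▸ a.2)
  · obtain ⟨h1, h2⟩ := key a (hA0 ha)
    refine ⟨fun w => (∑' b : A, if (b : ℂ) = a then 0 else t b w) - r ⟨a, ha⟩ w,
      h1.sub ((hrd ⟨a, ha⟩).analyticAt (isOpen_compl_singleton.mem_nhds (hA0 ha))), ?_⟩
    filter_upwards [h2] with w hw
    rw [hw.tsum_eq_add_tsum_ite ⟨a, ha⟩]
    simp only [Subtype.ext_iff, ht]
    ring

/-- The polar part of `φ / (w - a) ^ n` at `a`. -/
lemma exists_principalPart {a : ℂ} (n : ℕ) : ∀ {φ : ℂ → ℂ}, AnalyticAt ℂ φ a →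
    ∃ (Q : Polynomial ℂ) (ψ : ℂ → ℂ), AnalyticAt ℂ ψ a ∧
      ∀ w, w ≠ a → φ w / (w - a) ^ n = Q.eval (w - a)⁻¹ + ψ w := by
  induction n with
  | zero => exact fun {φ} hφ => ⟨0, φ, hφ, fun w _ => by simp⟩
  | succ n ih =>
    intro φ hφ
    have hd : AnalyticAt ℂ (dslope φ a) a := by
      obtain ⟨p, hp⟩ := hφ
      exact hp.has_fpower_series_dslope_fslope.analyticAt
    obtain ⟨Q, ψ, hψ, h⟩ := ih hd
    refine ⟨Q + Polynomial.C (φ a) * Polynomial.X ^ (n + 1), ψ, hψ, fun w hw => ?_⟩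
    have hwa : w - a ≠ 0 := sub_ne_zero.2 hw
    have h1 := h w hw
    rw [dslope_of_ne _ hw, slope_def_field] at h1
    simp only [Polynomial.eval_add, Polynomial.eval_mul, Polynomial.eval_C, Polynomial.eval_pow,
      Polynomial.eval_X, add_right_comm _ _ (ψ w)]
    rw [← h1, inv_pow]
    field_simp
    ring

/-- A nonvanishing analytic germ has an analytic logarithm. -/
lemma AnalyticAt.exists_exp_eq {f : ℂ → ℂ} {a : ℂ} (hf : AnalyticAt ℂ f a) (h0 : f a ≠ 0) :
    ∃ l : ℂ → ℂ, AnalyticAt ℂ l a ∧ ∀ᶠ w in 𝓝 a, Complex.exp (l w) = f w := by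
  refine ⟨fun w => Complex.log (f w / f a) + Complex.log (f a), ?_, ?_⟩
  · refine ((hf.div analyticAt_const h0).clog ?_).add analyticAt_const
    simp [h0]
  · filter_upwards [hf.continuousAt.eventually_ne h0] with w hw
    rw [Complex.exp_add, Complex.exp_log (div_ne_zero hw h0), Complex.exp_log h0,
      div_mul_cancel₀ _ h0]

/-- The zeros of a nontrivial holomorphic function on the punctured plane are isolated. -/
lemma eventually_ne_zero_of_differentiableOn_punctured {g : ℂ → ℂ}
    (hg : DifferentiableOn ℂ g {0}ᶜ) {w₀ : ℂ} (hw₀ : w₀ ≠ 0) (hgw₀ : g w₀ ≠ 0) {z : ℂ}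
    (hz : z ≠ 0) : ∀ᶠ w in 𝓝[≠] z, g w ≠ 0 := by
  have hga : AnalyticOnNhd ℂ g {0}ᶜ := hg.analyticOnNhd isOpen_compl_singleton
  refine (hga z hz).eventually_eq_zero_or_eventually_ne_zero.resolve_left fun h => hgw₀ ?_
  have hconn : IsPreconnected ({0}ᶜ : Set ℂ) :=
    (isConnected_compl_singleton_of_one_lt_rank
      (by simp [Complex.rank_real_complex]) 0).isPreconnected
  exact hga.eqOn_zero_of_preconnected_of_eventuallyEq_zero hconn hz h hw₀

/-- The ring of holomorphic functions on the punctured plane has stable rank one. -/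
lemma exists_add_mul_ne_zero_punctured {f g : ℂ → ℂ} (hf : DifferentiableOn ℂ f {0}ᶜ)
    (hg : DifferentiableOn ℂ g {0}ᶜ) (hfg : ∀ w, w ≠ 0 → g w = 0 → f w ≠ 0)
    {w₀ : ℂ} (hw₀ : w₀ ≠ 0) (hgw₀ : g w₀ ≠ 0) :
    ∃ e : ℂ → ℂ, DifferentiableOn ℂ e {0}ᶜ ∧ ∀ w, w ≠ 0 → f w + e w * g w ≠ 0 := by
  classical
  have hfa : AnalyticOnNhd ℂ f {0}ᶜ := hf.analyticOnNhd isOpen_compl_singleton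
  have hga : AnalyticOnNhd ℂ g {0}ᶜ := hg.analyticOnNhd isOpen_compl_singleton
  set A : Set ℂ := {w | w ≠ 0 ∧ g w = 0} with hAdef
  have hiso : ∀ z : ℂ, z ≠ 0 → ∀ᶠ w in 𝓝[≠] z, g w ≠ 0 := fun z hz =>
    eventually_ne_zero_of_differentiableOn_punctured hg hw₀ hgw₀ hz
  have hA0 : A ⊆ {0}ᶜ := fun w hw => hw.1
  have hA : ∀ z : ℂ, z ≠ 0 → ∀ᶠ w in 𝓝[≠] z, w ∉ A := fun z hz =>
    (hiso z hz).mono fun w hw h => hw h.2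
  have hloc : ∀ a ∈ A, ∃ (Q : Polynomial ℂ) (ψ l : ℂ → ℂ), AnalyticAt ℂ ψ a ∧
      (∀ᶠ w in 𝓝 a, Complex.exp (l w) = f w) ∧
      ∀ᶠ w in 𝓝[≠] a, l w / g w = Q.eval (w - a)⁻¹ + ψ w := by
    intro a ha
    obtain ⟨l, hl, hlf⟩ := (hfa a ha.1).exists_exp_eq (hfg a ha.1 ha.2)
    have htop : ¬ ∀ᶠ w in 𝓝 a, g w = 0 := fun h =>
      ((hiso a ha.1).and (h.filter_mono nhdsWithin_le_nhds)).exists.elim fun w hw => hw.1 hw.2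
    obtain ⟨n, G, hG, hG0, hgG⟩ :=
      (hga a ha.1).exists_eventuallyEq_pow_smul_nonzero_iff.2 htop
    obtain ⟨Q, ψ, hψ, h⟩ := exists_principalPart n (hl.div hG hG0)
    refine ⟨Q, ψ, l, hψ, hlf, ?_⟩
    filter_upwards [hgG.filter_mono nhdsWithin_le_nhds, self_mem_nhdsWithin] with w hw hwa
    rw [← h w hwa, hw, smul_eq_mul, Pi.div_apply, div_div, mul_comm (G w)]
  choose! Q ψ l hψ hlf hQ using hloc
  obtain ⟨m, hm, hmA⟩ := exists_mittagLeffler_punctured hA0 hA Q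
  choose! k hk hmk using hmA
  -- the extension of `(exp (m g) - f) / g` across the zero `a` of `g`
  set E : ℂ → ℂ → ℂ := fun a w =>
    f w * ((k a w - ψ a w) * dslope Complex.exp 0 (g w * (k a w - ψ a w))) with hE
  have hEa : ∀ a ∈ A, AnalyticAt ℂ (E a) a := by
    intro a ha
    have hd : ∀ z, AnalyticAt ℂ (dslope Complex.exp 0) z := by
      have : Differentiable ℂ (dslope Complex.exp 0) := by
        rw [← differentiableOn_univ, Complex.differentiableOn_dslope univ_mem]
        exact Complex.differentiable_exp.differentiableOn
      exact fun z => this.analyticAt z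
    have hd1 := (hk a ha).sub (hψ a ha)
    exact (hfa a ha.1).mul (hd1.mul ((hd _).comp ((hga a ha.1).mul hd1)))
  have hEe : ∀ a ∈ A, ∀ᶠ w in 𝓝[≠] a, (Complex.exp (m w * g w) - f w) / g w = E a w := by
    intro a ha
    filter_upwards [(hlf a ha).filter_mono nhdsWithin_le_nhds, hQ a ha,
      (hmk a ha).filter_mono nhdsWithin_le_nhds, hiso a ha.1] with w h1 h2 h3 h4
    have h5 : m w * g w = l a w + g w * (k a w - ψ a w) := by
      rw [h3, eq_sub_of_add_eq h2.symm]
      field_simp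
      ring
    have h6 := sub_smul_dslope Complex.exp 0 (g w * (k a w - ψ a w))
    rw [sub_zero, smul_eq_mul, Complex.exp_zero] at h6
    rw [h5, Complex.exp_add, h1, div_eq_iff h4, hE]
    linear_combination - f w * h6
  refine ⟨fun w => if w ∈ A then E w w else (Complex.exp (m w * g w) - f w) / g w, ?_, ?_⟩
  · intro z hz
    by_cases hzA : z ∈ A
    · refine ((hEa z hzA).congr ?_).differentiableAt.differentiableWithinAt
      filter_upwards [eventually_nhdsWithin_iff.1 (hEe z hzA),
        eventually_nhdsWithin_iff.1 (hA z hz)] with w h1 h2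
      by_cases hwz : w = z
      · rw [hwz, if_pos hzA]
      · rw [if_neg (h2 hwz), h1 hwz]
    · have hgz : g z ≠ 0 := fun h => hzA ⟨hz, h⟩
      have h1 : AnalyticAt ℂ (fun w => (Complex.exp (m w * g w) - f w) / g w) z :=
        ((((hm z hz hzA).mul (hga z hz)).cexp).sub (hfa z hz)).div (hga z hz) hgz
      refine (h1.congr ?_).differentiableAt.differentiableWithinAt
      filter_upwards [(hga z hz).continuousAt.eventually_ne hgz] with w hw
      exact (if_neg fun h => hw h.2).symm
  · intro w hw
    by_cases hwA : w ∈ A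
    · simpa [hwA.2] using hfg w hw hwA.2
    · have hgw : g w ≠ 0 := fun h => hwA ⟨hw, h⟩
      simp only [if_neg hwA, div_mul_cancel₀ _ hgw, add_sub_cancel]
      exact Complex.exp_ne_zero _

/-- `A` is a holomorphic family of automorphisms of `E` over the punctured plane, with fibrewise
inverse `B` which is again a holomorphic family. -/
structure IsAutFamily {E : Type*} [NormedAddCommGroup E] [NormedSpace ℂ E]
    (A B : ℂ × E → E) : Prop where
  differentiableOn : DifferentiableOn ℂ A ({w : ℂ | w ≠ 0} ×ˢ Set.univ)
  differentiableOn_inv : DifferentiableOn ℂ B ({w : ℂ | w ≠ 0} ×ˢ Set.univ)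
  left_inv : ∀ w, w ≠ 0 → ∀ z, B (w, A (w, z)) = z
  right_inv : ∀ w, w ≠ 0 → ∀ z, A (w, B (w, z)) = z

namespace IsAutFamily

section
variable {E : Type*} [NormedAddCommGroup E] [NormedSpace ℂ E] {A B A' B' : ℂ × E → E}

lemma symm (h : IsAutFamily A B) : IsAutFamily B A :=
  ⟨h.differentiableOn_inv, h.differentiableOn, h.right_inv, h.left_inv⟩

lemma differentiableOn_comp (h : IsAutFamily A B) {F : Type*} [NormedAddCommGroup F]
    [NormedSpace ℂ F] {s : Set F} {u : F → ℂ} {y : F → E} (hu : DifferentiableOn ℂ u s)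
    (hu0 : ∀ p ∈ s, u p ≠ 0) (hy : DifferentiableOn ℂ y s) :
    DifferentiableOn ℂ (fun p => A (u p, y p)) s :=
  h.differentiableOn.comp (hu.prodMk hy) fun p hp => ⟨hu0 p hp, Set.mem_univ _⟩

lemma trans (h : IsAutFamily A B) (h' : IsAutFamily A' B') :
    IsAutFamily (fun p => A' (p.1, A p)) (fun p => B (p.1, B' p)) where
  differentiableOn := h'.differentiableOn_comp differentiableOn_fst (fun _ hp => hp.1)
    h.differentiableOn
  differentiableOn_inv := h.symm.differentiableOn_comp differentiableOn_fst (fun _ hp => hp.1)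
    h'.differentiableOn_inv
  left_inv w hw z := by simp [h'.left_inv w hw, h.left_inv w hw]
  right_inv w hw z := by simp [h'.right_inv w hw, h.right_inv w hw]

lemma refl : IsAutFamily (E := E) Prod.snd Prod.snd :=
  ⟨differentiableOn_snd, differentiableOn_snd, fun _ _ _ => rfl, fun _ _ _ => rfl⟩

/-- A family of shears `z ↦ z + φ z • e w`. -/
lemma shear {φ : E → ℂ} {e : ℂ → E} (hφ : Differentiable ℂ φ) (he : DifferentiableOn ℂ e {0}ᶜ)
    (hinv : ∀ w z (c : ℂ), φ (z + c • e w) = φ z) :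
    IsAutFamily (fun p : ℂ × E => p.2 + φ p.2 • e p.1) (fun p => p.2 - φ p.2 • e p.1) := by
  have hφ' : DifferentiableOn ℂ (fun p : ℂ × E => φ p.2)
      ({w : ℂ | w ≠ 0} ×ˢ Set.univ) := (hφ.comp differentiable_snd).differentiableOn
  have he' : DifferentiableOn ℂ (fun p : ℂ × E => e p.1) ({w : ℂ | w ≠ 0} ×ˢ Set.univ) :=
    he.comp differentiableOn_fst fun p hp => hp.1
  refine ⟨differentiableOn_snd.add (hφ'.smul he'), differentiableOn_snd.sub (hφ'.smul he'),
    fun w _ z => ?_, fun w _ z => ?_⟩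
  · simp [hinv]
  · have : φ (z - φ z • e w) = φ z := by
      rw [sub_eq_add_neg, ← neg_smul, hinv]
    simp [this]

end

end IsAutFamily

section Moves

variable {n : ℕ} [NeZero n]

/-- The curve `y` is carried to `y'` by a holomorphic family of automorphisms of `ℂⁿ` fixing all
points `(s, 0, …, 0)` with `s ∈ S`. -/
def MovesTo (S : Finset ℂ) (y y' : ℂ → EuclideanSpace ℂ (Fin n)) : Prop :=
  ∃ A B : ℂ × EuclideanSpace ℂ (Fin n) → EuclideanSpace ℂ (Fin n), IsAutFamily A B ∧
    (∀ w, w ≠ 0 → ∀ s ∈ S, A (w, EuclideanSpace.single 0 s) = EuclideanSpace.single 0 s) ∧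
    ∀ w, w ≠ 0 → A (w, y w) = y' w

namespace MovesTo

variable {S : Finset ℂ} {y y' y'' : ℂ → EuclideanSpace ℂ (Fin n)}

lemma trans (h : MovesTo S y y') (h' : MovesTo S y' y'') : MovesTo S y y'' := by
  obtain ⟨A, B, hA, hAS, hAy⟩ := h
  obtain ⟨A', B', hA', hAS', hAy'⟩ := h'
  refine ⟨_, _, hA.trans hA', fun w hw s hs => ?_, fun w hw => ?_⟩
  · simp only [hAS w hw s hs, hAS' w hw s hs]
  · simp only [hAy w hw, hAy' w hw]

lemma differentiableOn (h : MovesTo S y y') (hy : DifferentiableOn ℂ y {0}ᶜ) :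
    DifferentiableOn ℂ y' {0}ᶜ := by
  obtain ⟨A, B, hA, -, hAy⟩ := h
  exact (hA.differentiableOn_comp differentiableOn_id (fun _ hp => hp) hy).congr
    fun w hw => (hAy w hw).symm

lemma ne_single (h : MovesTo S y y')
    (hy : ∀ w, w ≠ 0 → ∀ s ∈ S, y w ≠ EuclideanSpace.single 0 s) :
    ∀ w, w ≠ 0 → ∀ s ∈ S, y' w ≠ EuclideanSpace.single 0 s := by
  obtain ⟨A, B, hA, hAS, hAy⟩ := h
  intro w hw s hs heq
  refine hy w hw s hs ?_
  rw [← hA.left_inv w hw (y w), hAy w hw, heq]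
  nth_rw 1 [← hAS w hw s hs]
  exact hA.left_inv w hw _

lemma shear {φ : EuclideanSpace ℂ (Fin n) → ℂ} {e : ℂ → EuclideanSpace ℂ (Fin n)}
    (hφ : Differentiable ℂ φ) (he : DifferentiableOn ℂ e {0}ᶜ)
    (hinv : ∀ w z (c : ℂ), φ (z + c • e w) = φ z)
    (hφS : ∀ s ∈ S, φ (EuclideanSpace.single 0 s) = 0) :
    MovesTo S y (fun w => y w + φ (y w) • e w) :=
  ⟨_, _, IsAutFamily.shear hφ he hinv, fun w _ s hs => by simp [hφS s hs], fun _ _ => rfl⟩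

end MovesTo

lemma differentiableOn_single {n : ℕ} {f : ℂ → ℂ} {s : Set ℂ} (hf : DifferentiableOn ℂ f s)
    (i : Fin n) :
    DifferentiableOn ℂ (fun w => EuclideanSpace.single i (f w)) s := by
  rw [differentiableOn_euclidean]
  intro j
  by_cases h : j = i
  · subst h; simpa using hf
  · simp [h]

lemma differentiable_prod_sub {n : ℕ} (S : Finset ℂ) (i : Fin n) :
    Differentiable ℂ fun z : EuclideanSpace ℂ (Fin n) => ∏ s ∈ S, (z i - s) := by
  have h : Differentiable ℂ fun z : EuclideanSpace ℂ (Fin n) =>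
      (∏ s ∈ S, (Polynomial.X - Polynomial.C s)).eval (z i) :=
    (∏ s ∈ S, (Polynomial.X - Polynomial.C s)).differentiable.comp
      (show Differentiable ℂ fun z : EuclideanSpace ℂ (Fin n) => z i by fun_prop)
  simpa [Polynomial.eval_prod] using h

/-- After a move, the first coordinate does not lie in `S` identically. -/
lemma exists_movesTo_prod_ne_zero {S : Finset ℂ} {y : ℂ → EuclideanSpace ℂ (Fin n)}
    (hyS : ∀ w, w ≠ 0 → ∀ s ∈ S, y w ≠ EuclideanSpace.single 0 s) {q : ℂ} (hq : q ∉ S) :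
    ∃ y', MovesTo S y y' ∧ ∏ s ∈ S, (y' 1 0 - s) ≠ 0 := by
  have hP : ∀ {a : ℂ}, a ∉ S → ∏ s ∈ S, (a - s) ≠ 0 := fun {a} ha =>
    Finset.prod_ne_zero_iff.2 fun s hs h => ha (sub_eq_zero.1 h ▸ hs)
  by_cases h : ∃ j, j ≠ 0 ∧ y 1 j ≠ 0
  · obtain ⟨j, hj, hyj⟩ := h
    refine ⟨_, MovesTo.shear (φ := fun z => z j)
      (e := fun _ => EuclideanSpace.single 0 ((q - y 1 0) / y 1 j)) (by fun_prop)
      (differentiableOn_const _) (fun w z c => by simp [hj]) (fun s _ => by simp [hj]), ?_⟩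
    have : y 1 0 + y 1 j * ((q - y 1 0) / y 1 j) = q := by field_simp; ring
    simpa [this] using hP hq
  · push Not at h
    refine ⟨y, ⟨_, _, IsAutFamily.refl, fun _ _ _ _ => rfl, fun _ _ => rfl⟩, hP fun hmem => ?_⟩
    refine hyS 1 one_ne_zero _ hmem ?_
    ext j
    by_cases hj : j = 0
    · subst hj; simp
    · simp [hj, h j hj]

/-- For countably many vectors with a nonzero coordinate other than the first, some functional
`v ↦ v i + ∑ c ^ (j + 1) * v j`, with `j` ranging over the indices other than `0` and `i`, vanishes
on none of them. -/
lemma exists_pow_functional_ne_zero {A : Set ℂ} (hA : A.Countable) (i : Fin n)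
    {y : ℂ → EuclideanSpace ℂ (Fin n)} (hy : ∀ w ∈ A, ∃ j, j ≠ 0 ∧ y w j ≠ 0) :
    ∃ c : ℂ, ∀ w ∈ A, y w i +
      ∑ j : Fin n, (if j = 0 ∨ j = i then 0 else c ^ (j + 1 : ℕ)) * y w j ≠ 0 := by
  set p : ℂ → Polynomial ℂ := fun w => Polynomial.C (y w i) +
    ∑ j : Fin n, (if j = 0 ∨ j = i then 0 else Polynomial.X ^ (j + 1 : ℕ)) * Polynomial.C (y w j)
    with hp
  have hp0 : ∀ w ∈ A, p w ≠ 0 := by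
    intro w hw h0
    obtain ⟨j, hj, hyj⟩ := hy w hw
    have hterm : ∀ (k : Fin n) (d : ℕ),
        ((if k = 0 ∨ k = i then 0 else Polynomial.X ^ (k + 1 : ℕ)) *
          Polynomial.C (y w k)).coeff d =
        if ¬ (k = 0 ∨ k = i) ∧ d = k + 1 then y w k else 0 := by
      intro k d
      by_cases hk : k = 0 ∨ k = i <;> simp [hk, Polynomial.coeff_X_pow]
    have hcoeff : ∀ d, (p w).coeff d = 0 := by simp [h0]
    simp only [hp, Polynomial.coeff_add, Polynomial.finsetSum_coeff, hterm] at hcoeff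
    have hyi : y w i = 0 := by simpa using hcoeff 0
    have hji : j ≠ i := fun h => hyj (h ▸ hyi)
    refine hyj ?_
    have := hcoeff (j + 1)
    rw [Finset.sum_eq_single j (fun k _ hk => if_neg fun h => hk (Fin.ext (by omega))) (by simp)]
      at this
    simpa [hj, hji, Polynomial.coeff_C] using this
  have hcount : (⋃ w ∈ A, {c | (p w).IsRoot c}).Countable :=
    hA.biUnion fun w hw => (Polynomial.finite_setOfPred_isRoot (hp0 w hw)).countable
  obtain ⟨c, hc⟩ : ∃ c, c ∉ ⋃ w ∈ A, {c | (p w).IsRoot c} := by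
    by_contra! h
    exact not_countable_complex (hcount.mono fun c _ => h c)
  refine ⟨c, fun w hw h => hc ?_⟩
  simp only [Set.mem_iUnion]
  refine ⟨w, hw, ?_⟩
  simp only [Set.mem_ofPred_eq, Polynomial.IsRoot, hp, Polynomial.eval_add, Polynomial.eval_C,
    Polynomial.eval_finsetSum, Polynomial.eval_mul]
  convert h using 5
  split_ifs <;> simp

/-- A curve avoiding the points `(s, 0, …, 0)`, `s ∈ S`, can be moved to a further constant point of
the first axis. -/
lemma movesTo_single {S : Finset ℂ} (hn : 2 ≤ n) {y : ℂ → EuclideanSpace ℂ (Fin n)}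
    (hy : DifferentiableOn ℂ y {0}ᶜ)
    (hyS : ∀ w, w ≠ 0 → ∀ s ∈ S, y w ≠ EuclideanSpace.single 0 s) {q : ℂ} (hq : q ∉ S) :
    MovesTo S y (fun _ => EuclideanSpace.single 0 q) := by
  set i : Fin n := ⟨1, hn⟩ with hi
  have hi0 : i ≠ 0 := by simp [hi, Fin.ext_iff]
  have h0i : (0 : Fin n) ≠ i := hi0.symm
  have coord : ∀ {y : ℂ → EuclideanSpace ℂ (Fin n)}, DifferentiableOn ℂ y {0}ᶜ →
    ∀ j, DifferentiableOn ℂ (fun w => y w j) {0}ᶜ := fun h => differentiableOn_euclidean.1 h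
  have hPS : ∀ s ∈ S, ∏ r ∈ S, ((EuclideanSpace.single (0 : Fin n) s) 0 - r) = 0 := by
    intro s hs
    exact Finset.prod_eq_zero hs (by simp)
  have hPq : ∏ r ∈ S, (q - r) ≠ 0 :=
    Finset.prod_ne_zero_iff.2 fun s hs h => hq (sub_eq_zero.1 h ▸ hs)
  -- the first coordinate leaves `S` somewhere
  obtain ⟨y₁, hm₁, hy₁0⟩ := exists_movesTo_prod_ne_zero hyS hq
  have hy₁ := hm₁.differentiableOn hy
  have hP₁ : DifferentiableOn ℂ (fun w => ∏ s ∈ S, (y₁ w 0 - s)) {0}ᶜ :=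
    (differentiable_prod_sub S 0).comp_differentiableOn hy₁
  -- the second coordinate becomes nonzero wherever the first one lies in `S`
  have hA : {w : ℂ | w ≠ 0 ∧ ∏ s ∈ S, (y₁ w 0 - s) = 0}.Countable :=
    countable_of_discrete_punctured (fun w hw => hw.1) fun z hz =>
      (eventually_ne_zero_of_differentiableOn_punctured hP₁ one_ne_zero hy₁0 hz).mono
        fun w hw h => hw h.2
  obtain ⟨c, hc⟩ := exists_pow_functional_ne_zero hA i (y := y₁) (by
    rintro w ⟨hw, hw0⟩
    by_contra! h
    obtain ⟨s, hs, hs0⟩ := Finset.prod_eq_zero_iff.1 hw0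
    refine hm₁.ne_single hyS w hw s hs ?_
    ext j
    by_cases hj : j = 0
    · subst hj; simpa using sub_eq_zero.1 hs0
    · simp [hj, h j hj])
  have hm₂ : MovesTo S y₁ _ := MovesTo.shear
    (φ := fun z => ∑ j : Fin n, (if j = 0 ∨ j = i then 0 else c ^ (j + 1 : ℕ)) * z j)
    (e := fun _ => EuclideanSpace.single i 1) (by fun_prop) (differentiableOn_const _)
    (fun w z c => by
      refine Finset.sum_congr rfl fun j _ => ?_
      by_cases hj : j = i <;> simp [hj])
    (fun s _ => Finset.sum_eq_zero fun j _ => by by_cases hj : j = 0 <;> simp [hj])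
  set y₂ : ℂ → EuclideanSpace ℂ (Fin n) := fun w => y₁ w +
    (∑ j : Fin n, (if j = 0 ∨ j = i then 0 else c ^ (j + 1 : ℕ)) * y₁ w j) •
      EuclideanSpace.single i 1 with hy₂def
  have hy₂ := hm₂.differentiableOn hy₁
  have hy₂0 : ∀ w, y₂ w 0 = y₁ w 0 := fun w => by simp [hy₂def, h0i]
  -- the second coordinate becomes nowhere zero
  obtain ⟨e, he, hne⟩ := exists_add_mul_ne_zero_punctured (coord hy₂ i) hP₁
    (fun w hw hw0 => by simpa [hy₂def] using hc w ⟨hw, hw0⟩) one_ne_zero hy₁0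
  have hm₃ : MovesTo S y₂ _ := MovesTo.shear (φ := fun z => ∏ s ∈ S, (z 0 - s))
    (e := fun w => EuclideanSpace.single i (e w)) (differentiable_prod_sub S 0)
    (differentiableOn_single he i) (fun w z c => by simp [h0i]) hPS
  set y₃ : ℂ → EuclideanSpace ℂ (Fin n) := fun w => y₂ w +
    (∏ s ∈ S, (y₂ w 0 - s)) • EuclideanSpace.single i (e w) with hy₃def
  have hy₃ := hm₃.differentiableOn hy₂
  have hy₃i : ∀ w, w ≠ 0 → y₃ w i ≠ 0 := fun w hw => by
    simpa [hy₃def, hy₂0, mul_comm] using hne w hw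
  -- the first coordinate becomes `q`
  have hm₄ : MovesTo S y₃ _ := MovesTo.shear (φ := fun z => z i)
    (e := fun w => EuclideanSpace.single 0 ((q - y₃ w 0) / y₃ w i)) (by fun_prop)
    (differentiableOn_single (((differentiableOn_const q).sub (coord hy₃ 0)).div (coord hy₃ i)
      hy₃i) 0) (fun w z c => by simp [hi0]) (fun s _ => by simp [hi0])
  set y₄ : ℂ → EuclideanSpace ℂ (Fin n) := fun w => y₃ w +
    y₃ w i • EuclideanSpace.single 0 ((q - y₃ w 0) / y₃ w i) with hy₄def
  have hy₄ := hm₄.differentiableOn hy₃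
  have hy₄0 : ∀ w, w ≠ 0 → y₄ w 0 = q := fun w hw => by
    have := hy₃i w hw
    simp [hy₄def]
    field_simp
    ring
  -- the remaining coordinates become zero
  have hm₅ : MovesTo S y₄ _ := MovesTo.shear (φ := fun z => ∏ s ∈ S, (z 0 - s))
    (e := fun w => (∏ s ∈ S, (q - s))⁻¹ • (EuclideanSpace.single 0 (y₄ w 0) - y₄ w))
    (differentiable_prod_sub S 0)
    (((differentiableOn_single (coord hy₄ 0) 0).fun_sub hy₄).fun_const_smul _)
    (fun w z c => by simp) hPS
  have hm := (((hm₁.trans hm₂).trans hm₃).trans hm₄).trans hm₅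
  obtain ⟨A, B, hAB, hAS, hAy⟩ := hm
  refine ⟨A, B, hAB, hAS, fun w hw => ?_⟩
  rw [hAy w hw]
  simp only [hy₄0 w hw, smul_smul, mul_inv_cancel₀ hPq, one_smul, add_sub_cancel]

/-- Every holomorphic curve of configurations can be straightened to a standard configuration. -/
lemma exists_isAutFamily_eq_single (hn : 2 ≤ n) (N : ℕ) :
    ∀ x : Fin N → ℂ → EuclideanSpace ℂ (Fin n), (∀ i, DifferentiableOn ℂ (x i) {0}ᶜ) →
      (∀ i j, i ≠ j → ∀ w : ℂ, w ≠ 0 → x i w ≠ x j w) →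
      ∃ A B : ℂ × EuclideanSpace ℂ (Fin n) → EuclideanSpace ℂ (Fin n), IsAutFamily A B ∧
        ∀ w, w ≠ 0 → ∀ i, A (w, x i w) = EuclideanSpace.single 0 ((i : ℕ) : ℂ) := by
  classical
  induction N with
  | zero => exact fun _ _ _ => ⟨_, _, IsAutFamily.refl, fun _ _ i => i.elim0⟩
  | succ N ih =>
    intro x hx hne
    obtain ⟨A, B, hAB, hA⟩ := ih (fun i => x i.castSucc) (fun i => hx _)
      (fun i j hij => hne _ _ fun h => hij (Fin.castSucc_injective N h))
    set S : Finset ℂ := (Finset.range N).image fun k : ℕ => (k : ℂ) with hS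
    obtain ⟨A', B', hAB', hAS, hAy⟩ := movesTo_single (S := S) (q := (N : ℂ)) hn
      (hAB.differentiableOn_comp differentiableOn_id (fun _ hp => hp) (hx (Fin.last N)))
      (by
        intro w hw s hs heq
        obtain ⟨k, hk, rfl⟩ := Finset.mem_image.1 hs
        have h := hA w hw ⟨k, Finset.mem_range.1 hk⟩
        refine hne _ _ (Fin.castSucc_lt_last ⟨k, Finset.mem_range.1 hk⟩).ne w hw ?_
        rw [← hAB.left_inv w hw (x (Fin.castSucc _) w), h, ← heq]
        exact hAB.left_inv w hw _)
      (by simp [hS])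
    refine ⟨_, _, hAB.trans hAB', fun w hw i => ?_⟩
    induction i using Fin.lastCases with
    | last => simpa using hAy w hw
    | cast i =>
      simp only [hA w hw i, Fin.val_castSucc]
      exact hAS w hw _ (Finset.mem_image_of_mem _ (Finset.mem_range.2 i.2))

end Moves

/-- existence direction of parametric point interpolation for `X = ℂⁿ`
(n ≥ 2) with Stein parameter space `W = ℂ \ {0}`: if the parametrized configuration
`x = (x₁,…,x_N) : W → (ℂⁿ)ᴺ \ Δ` is null-homotopic within `(ℂⁿ)ᴺ \ Δ`, then there is a
holomorphic family of holomorphic automorphisms `α(w,·)` of `ℂⁿ` with `α(w, x̂ᵢ) = xᵢ(w)`. -/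
theorem parametric_point_interpolation_punctured_plane
    (n N : ℕ) (hn : 2 ≤ n) (hN : 1 ≤ N)
    (xh : Fin N → EuclideanSpace ℂ (Fin n)) (hxh : Function.Injective xh)
    (x : Fin N → ℂ → EuclideanSpace ℂ (Fin n))
    (hx : ∀ i, DifferentiableOn ℂ (x i) {0}ᶜ)
    (hx' : ∀ i j, i ≠ j → ∀ w : ℂ, w ≠ 0 → x i w ≠ x j w)
    (hnull : ∃ H : unitInterval × {w : ℂ // w ≠ 0} → (Fin N → EuclideanSpace ℂ (Fin n)),
      Continuous H ∧
      (∀ t w i j, i ≠ j → H (t, w) i ≠ H (t, w) j) ∧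
      (∀ w : {w : ℂ // w ≠ 0}, H (0, w) = fun i => x i w.1) ∧
      (∃ c, ∀ w, H (1, w) = c)) :
    ∃ α : ℂ × EuclideanSpace ℂ (Fin n) → EuclideanSpace ℂ (Fin n),
      DifferentiableOn ℂ α ({w : ℂ | w ≠ 0} ×ˢ (Set.univ : Set (EuclideanSpace ℂ (Fin n)))) ∧
      (∀ w : ℂ, w ≠ 0 →
        (∃ G : EuclideanSpace ℂ (Fin n) → EuclideanSpace ℂ (Fin n),
          Differentiable ℂ G ∧ (∀ z, G (α (w, z)) = z) ∧ (∀ z, α (w, G z) = z)) ∧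
        (∀ i, α (w, xh i) = x i w)) := by
  have : NeZero n := ⟨by omega⟩
  obtain ⟨A, B, hAB, hA⟩ := exists_isAutFamily_eq_single hn N (fun i _ => xh i)
    (fun i => differentiableOn_const _) (fun i j hij _ _ => hxh.ne hij)
  obtain ⟨A', B', hAB', hA'⟩ := exists_isAutFamily_eq_single hn N x hx hx'
  have h := hAB.trans hAB'.symm
  refine ⟨_, h.differentiableOn, fun w hw => ⟨⟨_, ?_, h.left_inv w hw, h.right_inv w hw⟩, ?_⟩⟩
  · exact differentiableOn_univ.1 (h.symm.differentiableOn_comp (differentiableOn_const w)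
      (fun _ _ => hw) differentiableOn_id)
  · intro i
    simp only [hA w hw i, ← hA' w hw i, hAB'.left_inv w hw]
end
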